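/- Let F be an algebraically closed field of characteristic 0, n ≥ 2, f ∈ F[X] a disintegrated polynomial of degree at least 2, φ = (f,…,f) the diagonally split self-map of (P^1_F)^n, and V an irreducible φ-periodic subvariety of (P^1_F)^n. Let I = {1,…,n}, let I_V be the set of indices i such that V is contained in a hypersurface x_i = ζ with ζ an f-periodic point, and define the relation ≺ on I by: i ≺ i for every i ∈ I∖I_V, and for distinct i, j ∈ I∖I_V, i ≺ j if V is contained in a hypersurface x_j = g(x_i) for some polynomial g commuting with some iterate of f. Then: (a) if i ≺ j and j ≺ k then i ≺ k; (b) if i ≺ j and i ≺ k then j ≺ k or k ≺ j; (c) if i ≺ k and j ≺ k then i ≺ j or j ≺ i. -/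

import Mathlib

open Polynomial OnePoint

/-- Action of a polynomial on the projective line `P^1(L) = L ∪ {∞}`:
`∞ ↦ ∞` and `a ↦ f(a)`. -/
def polyEvalP1 {L : Type} [CommRing L] (f : Polynomial L) : OnePoint L → OnePoint L :=
  OnePoint.map fun a => f.eval a

/-- The diagonally split self-map `(f,…,f)` of `(P^1)^n` (coordinatewise action). -/
def splitMap {L : Type} [CommRing L] {ι : Type} (f : Polynomial L)
    (x : ι → OnePoint L) : ι → OnePoint L :=
  fun i => polyEvalP1 f (x i)

/-- The forward orbit of a point under a self-map. -/
def fwdOrbit {X : Type*} (φ : X → X) (P : X) : Set X :=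
  Set.range fun k : ℕ => φ^[k] P

/-- Homogeneous coordinates of a point of `P^1(L)`: `a ↦ (a, 1)`, `∞ ↦ (1, 0)`. -/
def homCoords {L : Type} [CommRing L] (x : OnePoint L) : Fin 2 → L :=
  Option.elim x ![1, 0] (fun a => ![a, 1])

/-- A polynomial in variables `(i, 0), (i, 1)` (`i : ι`) is multihomogeneous if it is
homogeneous in the pair of variables indexed by each `i` separately. -/
def MultiHomog {K : Type} [CommSemiring K] {ι : Type} [DecidableEq ι]
    (p : MvPolynomial (ι × Fin 2) K) : Prop :=
  ∀ i : ι, ∃ d : ℕ,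
    p.IsWeightedHomogeneous (fun jk => if jk.1 = i then (1 : ℕ) else 0) d

/-- A closed subvariety of `(P^1_K)^ι`, given by a set of multihomogeneous equations over `K`. -/
structure ClosedSubvar (K : Type) [CommRing K] (ι : Type) [DecidableEq ι] where
  polys : Set (MvPolynomial (ι × Fin 2) K)
  homog : ∀ p ∈ polys, MultiHomog p

/-- Whether a multihomogeneous polynomial vanishes at a point of `(P^1(L))^ι`. -/
def vanishesAt {K : Type} [CommRing K] {ι : Type} [DecidableEq ι] {L : Type} [CommRing L]
    (φ : K →+* L) (p : MvPolynomial (ι × Fin 2) K) (x : ι → OnePoint L) : Prop :=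
  MvPolynomial.eval (fun jk => homCoords (x jk.1) jk.2) (MvPolynomial.map φ p) = 0

/-- The `L`-points of a closed subvariety, for a `K`-algebra `L` via `φ : K →+* L`. -/
def ClosedSubvar.pts {K : Type} [CommRing K] {ι : Type} [DecidableEq ι]
    (V : ClosedSubvar K ι) {L : Type} [CommRing L] (φ : K →+* L) :
    Set (ι → OnePoint L) :=
  {x | ∀ p ∈ V.polys, vanishesAt φ p x}

/-- A subset of `(P^1(L))^ι` is Zariski closed if it is the common zero set of a family of
multihomogeneous polynomials over `L`. -/
def IsZarClosed {L : Type} [CommRing L] {ι : Type} [DecidableEq ι]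
    (S : Set (ι → OnePoint L)) : Prop :=
  ∃ V : ClosedSubvar L ι, S = V.pts (RingHom.id L)

/-- The Zariski closure of a set of points. -/
def zarClosure {L : Type} [CommRing L] {ι : Type} [DecidableEq ι]
    (S : Set (ι → OnePoint L)) : Set (ι → OnePoint L) :=
  ⋂₀ {Z | IsZarClosed Z ∧ S ⊆ Z}

/-- An irreducible (closed) subvariety of `(P^1(L))^ι`, as a set of points. -/
def IrrSubvar {L : Type} [CommRing L] {ι : Type} [DecidableEq ι]
    (S : Set (ι → OnePoint L)) : Prop :=
  S.Nonempty ∧ IsZarClosed S ∧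
    ∀ Z₁ Z₂ : Set (ι → OnePoint L), IsZarClosed Z₁ → IsZarClosed Z₂ →
      S ⊆ Z₁ ∪ Z₂ → S ⊆ Z₁ ∨ S ⊆ Z₂

/-- The dimension of a (closed) subvariety, as the Krull dimension of the poset of
irreducible closed subsets contained in it. -/
noncomputable def varDim {L : Type} [CommRing L] {ι : Type} [DecidableEq ι]
    (S : Set (ι → OnePoint L)) : WithBot ℕ∞ :=
  Order.krullDim {T : Set (ι → OnePoint L) // IrrSubvar T ∧ T ⊆ S}

/-- `T` is an irreducible component of `S`: a maximal irreducible closed subset of `S`. -/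
def IsComponentOf {L : Type} [CommRing L] {ι : Type} [DecidableEq ι]
    (T S : Set (ι → OnePoint L)) : Prop :=
  IrrSubvar T ∧ T ⊆ S ∧ ∀ T', IrrSubvar T' → T ⊆ T' → T' ⊆ S → T' = T

/-- A hypersurface in `(P^1(L))^n`: a nonempty Zariski closed set all of whose irreducible
components have dimension `n - 1`. -/
def IsHypersurfaceSet {L : Type} [CommRing L] {n : ℕ}
    (S : Set (Fin n → OnePoint L)) : Prop :=
  S.Nonempty ∧ IsZarClosed S ∧
    ∀ T, IsComponentOf T S → varDim T = ((n - 1 : ℕ) : ℕ∞)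

/-- A set of points (e.g. a subvariety) is periodic under the split map `(f,…,f)`. -/
def SubvarPeriodic {L : Type} [CommRing L] {ι : Type} (f : Polynomial L)
    (S : Set (ι → OnePoint L)) : Prop :=
  ∃ m : ℕ, 1 ≤ m ∧ (splitMap f)^[m] '' S = S

/-- A set of points (e.g. a subvariety) is preparation under `(f,…,f)`. -/
def SubvarPreperiodic {L : Type} [CommRing L] {ι : Type} (f : Polynomial L)
    (S : Set (ι → OnePoint L)) : Prop :=
  ∃ k : ℕ, SubvarPeriodic f ((splitMap f)^[k] '' S)

/-- The `m`-th compositional iterate of a polynomial. -/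
noncomputable def polIter {F : Type} [CommSemiring F] (f : Polynomial F) : ℕ → Polynomial F
  | 0 => X
  | m + 1 => f.comp (polIter f m)

/-- Two polynomials commute under composition. -/
def PolyCommute {F : Type} [CommSemiring F] (f g : Polynomial F) : Prop :=
  f.comp g = g.comp f

/-- `g` commutes with some iterate `f^m` (`m ≥ 1`) of `f`. -/
def CommutesWithIterate {F : Type} [CommSemiring F] (f g : Polynomial F) : Prop :=
  ∃ m : ℕ, 1 ≤ m ∧ PolyCommute (polIter f m) g

/-- `c` is the Chebyshev polynomial of degree `d`, characterized by
`c(x + 1/x) = x^d + 1/x^d`. -/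
def IsChebyshevPoly {F : Type} [Field F] (d : ℕ) (c : Polynomial F) : Prop :=
  ∀ x : F, x ≠ 0 → c.eval (x + x⁻¹) = x ^ d + (x⁻¹) ^ d

/-- A polynomial over an algebraically closed field (or any field containing the relevant
conjugating data) is special if it is affinely conjugate to `X^d` or to `±C_d`. -/
def IsSpecialPolyAux {F : Type} [Field F] (f : Polynomial F) : Prop :=
  ∃ (a b : F), a ≠ 0 ∧
    ∃ g : Polynomial F,
      (g = X ^ f.natDegree ∨ IsChebyshevPoly f.natDegree g ∨
        IsChebyshevPoly f.natDegree (-g)) ∧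
      (C a * X + C b).comp g = f.comp (C a * X + C b)

/-- A polynomial over `K` is special if it becomes special (conjugate to `X^d` or `±C_d`)
over an algebraic closure of `K`. -/
def IsSpecialPoly {K : Type} [Field K] (f : Polynomial K) : Prop :=
  IsSpecialPolyAux (f.map (algebraMap K (AlgebraicClosure K)))

/-- A polynomial of degree at least 2 is disintegrated if it is not special. -/
def IsDisintegrated {K : Type} [Field K] (f : Polynomial K) : Prop :=
  2 ≤ f.natDegree ∧ ¬ IsSpecialPoly f

/-- A point of `P^1` is periodic under (the `P^1`-action of) a polynomial. -/
def P1Periodic {L : Type} [CommRing L] (f : Polynomial L) (ζ : OnePoint L) : Prop :=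
  ∃ N : ℕ, 1 ≤ N ∧ (OnePoint.map fun a => f.eval a)^[N] ζ = ζ

/-- A point of `P^1` is preperiodic under a polynomial. -/
def P1Preperiodic {L : Type} [CommRing L] (f : Polynomial L) (ζ : OnePoint L) : Prop :=
  ∃ k : ℕ, P1Periodic f ((OnePoint.map fun a => f.eval a)^[k] ζ)


/-- For an algebraically closed base field, `f` is disintegrated if it is not affinely
conjugate (over the field itself) to `X^d` or `±C_d`. -/
def IsDisintegratedAux {F : Type} [Field F] (f : Polynomial F) : Prop :=
  2 ≤ f.natDegree ∧ ¬ IsSpecialPolyAux f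

/-- `i ∈ I_V`: the subvariety (point set) `S` is contained in a hypersurface `x_i = ζ`
with `ζ` an `f`-periodic point of `P^1`. -/
def memIV {F : Type} [Field F] {n : ℕ} (f : Polynomial F)
    (S : Set (Fin n → OnePoint F)) (i : Fin n) : Prop :=
  ∃ ζ : OnePoint F, P1Periodic f ζ ∧ ∀ x ∈ S, x i = ζ

/-- The relation `≺` attached to a periodic subvariety `S`: `i ≺ i` for `i ∉ I_V`, and for
distinct `i, j ∉ I_V`, `i ≺ j` when `S` is contained in a hypersurface `x_j = g(x_i)` for
some polynomial `g` commuting with an iterate of `f`. -/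
def precRel {F : Type} [Field F] {n : ℕ} (f : Polynomial F)
    (S : Set (Fin n → OnePoint F)) (i j : Fin n) : Prop :=
  ¬ memIV f S i ∧ ¬ memIV f S j ∧
    (i = j ∨ ∃ g : Polynomial F, CommutesWithIterate f g ∧
      ∀ x ∈ S, x j = polyEvalP1 g (x i))

namespace PolyDyn

section Multiplicity

variable {F : Type*} [Field F]

/-- The local multiplicity of `P` at `q`. -/
noncomputable def mu (P : F[X]) (q : F) : ℕ := (P - C (P.eval q)).rootMultiplicity q

open Classical in
/-- The fibre `P⁻¹(y)` as a finset. -/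
noncomputable def fib (P : F[X]) (y : F) : Finset F := (P - C y).roots.toFinset

theorem sub_C_ne_zero {P : F[X]} (hP : 0 < P.natDegree) (y : F) : P - C y ≠ 0 := by
  intro h
  rw [← natDegree_sub_C (p := P) (a := y), h] at hP
  simp at hP

theorem mem_fib {P : F[X]} (hP : 0 < P.natDegree) {y q : F} :
    q ∈ fib P y ↔ P.eval q = y := by
  classical
  simp [fib, sub_C_ne_zero hP, sub_eq_zero]

theorem mu_eq {P : F[X]} {y q : F} (h : P.eval q = y) :
    mu P q = (P - C y).rootMultiplicity q := by
  rw [mu, h]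

theorem mu_pos {P : F[X]} (hP : 0 < P.natDegree) (q : F) : 0 < mu P q := by
  rw [mu, rootMultiplicity_pos (sub_C_ne_zero hP _)]
  simp

theorem mu_le (P : F[X]) (q : F) : mu P q ≤ P.natDegree := by
  classical
  rw [mu, ← count_roots]
  refine (Multiset.count_le_card _ _).trans ((card_roots' _).trans ?_)
  rw [natDegree_sub_C]

theorem sum_mu [IsAlgClosed F] {P : F[X]} (hP : 0 < P.natDegree) (y : F) :
    ∑ q ∈ fib P y, mu P q = P.natDegree := by
  classical
  have h1 : ∑ q ∈ fib P y, mu P q = ∑ q ∈ fib P y, (P - C y).roots.count q := by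
    refine Finset.sum_congr rfl fun q hq => ?_
    rw [mu_eq ((mem_fib hP).1 hq), count_roots]
  rw [h1, fib, Multiset.toFinset_sum_count_eq,
    ← (IsAlgClosed.splits (P - C y)).natDegree_eq_card_roots, natDegree_sub_C]

theorem mu_comp {P Q : F[X]} (hP : 0 < P.natDegree) (hQ : 0 < Q.natDegree) (q : F) :
    mu (P.comp Q) q = mu P (Q.eval q) * mu Q q := by
  classical
  obtain ⟨R, hR, hRn⟩ := exists_eq_pow_rootMultiplicity_mul_and_not_dvd
    (P - C (P.eval (Q.eval q))) (sub_C_ne_zero hP _) (Q.eval q)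
  have h0 : R.eval (Q.eval q) ≠ 0 := fun h => hRn (dvd_iff_isRoot.2 h)
  have h2 : P.comp Q - C ((P.comp Q).eval q) =
      (Q - C (Q.eval q)) ^ (mu P (Q.eval q)) * R.comp Q := by
    have := congrArg (fun S => S.comp Q) hR
    simp only [sub_comp, C_comp, mul_comp, pow_comp, X_comp] at this
    rw [eval_comp, this, mu]
  have h3 : (R.comp Q).eval q ≠ 0 := by rwa [eval_comp]
  have h4 : R.comp Q ≠ 0 := by
    rintro h
    rw [h] at h3
    simp at h3
  have hQ0 := sub_C_ne_zero hQ (Q.eval q)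
  rw [mu, h2, rootMultiplicity_mul (mul_ne_zero (pow_ne_zero _ hQ0) h4),
    rootMultiplicity_eq_zero h3, add_zero]
  rw [← count_roots, roots_pow, Multiset.count_nsmul, count_roots]
  rfl

theorem mu_derivative [CharZero F] {P : F[X]} (q : F) :
    (derivative P).rootMultiplicity q = mu P q - 1 := by
  have := derivative_rootMultiplicity_of_root (p := P - C (P.eval q)) (t := q) (by simp)
  simpa [mu] using this

theorem sum_mu_sub_one_le [CharZero F] {P : F[X]} (hP : 0 < P.natDegree) (S : Finset F) :
    ∑ q ∈ S, (mu P q - 1) ≤ P.natDegree - 1 := by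
  classical
  have hd : derivative P ≠ 0 := fun h => hP.ne' (derivative_eq_zero.1 h)
  calc ∑ q ∈ S, (mu P q - 1) = ∑ q ∈ S, (derivative P).roots.count q := by
        refine Finset.sum_congr rfl fun q _ => ?_
        rw [count_roots, mu_derivative]
    _ ≤ (derivative P).roots.card := by
        rw [← Multiset.sum_count_eq_card (s := S ∪ (derivative P).roots.toFinset)
          (fun a ha => Finset.mem_union_right _ (Multiset.mem_toFinset.2 ha))]
        exact Finset.sum_le_sum_of_subset Finset.subset_union_left
    _ ≤ P.natDegree - 1 := (card_roots' _).trans (natDegree_derivative_le P)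

theorem card_fib_sum [IsAlgClosed F] [CharZero F] {P : F[X]} (hP : 0 < P.natDegree)
    (T : Finset F) :
    T.card * P.natDegree ≤ ∑ y ∈ T, (fib P y).card + (P.natDegree - 1) := by
  classical
  have h1 : ∀ y ∈ T, P.natDegree = ∑ q ∈ fib P y, (mu P q - 1) + (fib P y).card := by
    intro y _
    rw [← sum_mu hP y, Finset.card_eq_sum_ones, ← Finset.sum_add_distrib]
    refine Finset.sum_congr rfl fun q _ => ?_
    have := mu_pos hP q
    omega
  have h2 : T.card * P.natDegree = ∑ y ∈ T, (∑ q ∈ fib P y, (mu P q - 1) + (fib P y).card) := by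
    rw [← Finset.sum_congr rfl h1]; simp
  have hdisj : (T : Set F).PairwiseDisjoint (fib P) := by
    intro a _ b _ hab
    rw [Function.onFun, Finset.disjoint_left]
    intro q hq hq'
    rw [mem_fib hP] at hq hq'
    exact hab (hq.symm.trans hq')
  rw [h2, Finset.sum_add_distrib, ← Finset.sum_biUnion hdisj]
  have := sum_mu_sub_one_le hP (T.biUnion (fib P))
  omega

end Multiplicity

section Iterates

variable {F : Type} [Field F]

theorem natDegree_comp_pos {p q : F[X]} (hp : 0 < p.natDegree) (hq : 0 < q.natDegree) :
    0 < (p.comp q).natDegree := by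
  rw [natDegree_comp]; positivity

theorem comp_right_cancel {a b g : F[X]} (hg : 0 < g.natDegree) (h : a.comp g = b.comp g) :
    a = b := by
  have h1 : (a - b).comp g = 0 := by rw [sub_comp, h, sub_self]
  rcases comp_eq_zero_iff.1 h1 with h2 | ⟨_, h2⟩
  · exact sub_eq_zero.1 h2
  · rw [h2] at hg; simp at hg

theorem polIter_one (f : F[X]) : polIter f 1 = f := by simp [polIter]

theorem polIter_add (f : F[X]) (a b : ℕ) :
    polIter f (a + b) = (polIter f a).comp (polIter f b) := by
  induction a with
  | zero => simp [polIter]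
  | succ a ih => rw [Nat.succ_add, polIter, polIter, ih, comp_assoc]

theorem polIter_succ_right (f : F[X]) (a : ℕ) : polIter f (a + 1) = (polIter f a).comp f := by
  rw [polIter_add, polIter_one]

theorem polIter_mul (f : F[X]) (a b : ℕ) : polIter f (a * b) = polIter (polIter f a) b := by
  induction b with
  | zero => simp [polIter]
  | succ b ih => rw [Nat.mul_succ, add_comm, polIter_add, ih, polIter]

theorem natDegree_polIter (f : F[X]) (k : ℕ) : (polIter f k).natDegree = f.natDegree ^ k := by
  induction k with
  | zero => simp [polIter]
  | succ k ih => rw [polIter, natDegree_comp, ih, pow_succ']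

theorem natDegree_polIter_pos {f : F[X]} (hf : 0 < f.natDegree) (k : ℕ) :
    0 < (polIter f k).natDegree := by
  rw [natDegree_polIter]; positivity

theorem eval_polIter (f : F[X]) (k : ℕ) (x : F) :
    (polIter f k).eval x = (fun y => f.eval y)^[k] x := by
  induction k with
  | zero => simp [polIter]
  | succ k ih => rw [polIter, eval_comp, ih, Function.iterate_succ_apply']

theorem _root_.PolyCommute.symm {f g : F[X]} (h : PolyCommute f g) : PolyCommute g f := Eq.symm h

theorem _root_.PolyCommute.refl (f : F[X]) : PolyCommute f f := rfl

theorem _root_.PolyCommute.comp_right {f g h : F[X]} (hg : PolyCommute f g) (hh : PolyCommute f h) :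
    PolyCommute f (g.comp h) := by
  unfold PolyCommute at *
  rw [← comp_assoc, hg, comp_assoc, hh, comp_assoc]

theorem _root_.PolyCommute.iter_right {f g : F[X]} (h : PolyCommute f g) (k : ℕ) :
    PolyCommute f (polIter g k) := by
  induction k with
  | zero => simp [polIter, PolyCommute]
  | succ k ih => exact PolyCommute.comp_right h ih

theorem _root_.PolyCommute.iter_left {f g : F[X]} (h : PolyCommute f g) (k : ℕ) :
    PolyCommute (polIter f k) g := (h.symm.iter_right k).symm

theorem _root_.PolyCommute.leadingCoeff {f g : F[X]} (h : PolyCommute f g) (hf : 2 ≤ f.natDegree)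
    (hg : 0 < g.natDegree) :
    g.leadingCoeff ^ (f.natDegree - 1) = f.leadingCoeff ^ (g.natDegree - 1) := by
  have h1 := congrArg Polynomial.leadingCoeff (show f.comp g = g.comp f from h)
  rw [leadingCoeff_comp hg.ne', leadingCoeff_comp (by omega)] at h1
  obtain ⟨a, ha⟩ : ∃ a, f.natDegree = a + 1 := ⟨f.natDegree - 1, by omega⟩
  obtain ⟨b, hb⟩ : ∃ b, g.natDegree = b + 1 := ⟨g.natDegree - 1, by omega⟩
  rw [ha, hb, pow_succ, pow_succ] at h1
  rw [ha, hb]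
  have hf0 : f.leadingCoeff ≠ 0 := leadingCoeff_ne_zero.2 (by rintro rfl; simp at ha)
  have hg0 : g.leadingCoeff ≠ 0 := leadingCoeff_ne_zero.2 (by rintro rfl; simp at hb)
  have h2 : f.leadingCoeff * g.leadingCoeff * g.leadingCoeff ^ a =
      f.leadingCoeff * g.leadingCoeff * f.leadingCoeff ^ b := by linear_combination h1
  simpa using mul_left_cancel₀ (mul_ne_zero hf0 hg0) h2

/-- Two polynomials of the same positive degree and leading coefficient commuting with a common
nonlinear polynomial are equal. -/
theorem _root_.PolyCommute.unique [CharZero F] {f g₁ g₂ : F[X]} (hf : 2 ≤ f.natDegree)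
    (h₁ : PolyCommute f g₁) (h₂ : PolyCommute f g₂) (hpos : 0 < g₁.natDegree)
    (hdeg : g₁.natDegree = g₂.natDegree) (hlead : g₁.leadingCoeff = g₂.leadingCoeff) :
    g₁ = g₂ := by
  by_contra hne
  set k := g₁.natDegree with hk
  set D := f.natDegree with hD
  set E := g₁ - g₂ with hE
  have hE0 : E ≠ 0 := sub_ne_zero.2 hne
  have hEdeg : E.natDegree < k := by
    have := degree_sub_lt_left (p := g₁) (q := g₂)
      (by rw [degree_eq_natDegree, degree_eq_natDegree, ← hk, hdeg] <;>
            (rintro rfl; simp_all)) (by rintro rfl; simp_all) hlead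
    exact natDegree_lt_natDegree hE0 this
  let G : ℕ → F[X] := fun i => ∑ j ∈ Finset.range i, g₁ ^ j * g₂ ^ (i - 1 - j)
  let Q : F[X] := ∑ i ∈ Finset.range (D + 1), C (f.coeff i) * G i
  have hQ : E.comp f = Q * E := by
    rw [hE, sub_comp, ← h₁, ← h₂, comp_eq_sum_left, comp_eq_sum_left,
      sum_over_range' _ (by simp) (D + 1) (Nat.lt_succ_self _),
      sum_over_range' _ (by simp) (D + 1) (Nat.lt_succ_self _), ← Finset.sum_sub_distrib,
      Finset.sum_mul]
    refine Finset.sum_congr rfl fun i _ => ?_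
    rw [mul_assoc, geom_sum₂_mul, mul_sub]
  have hterm : ∀ i j, j < i → (g₁ ^ j * g₂ ^ (i - 1 - j)).natDegree ≤ (i - 1) * k := by
    intro i j hj
    refine natDegree_mul_le.trans ?_
    rw [natDegree_pow, natDegree_pow, ← hdeg, ← hk, ← add_mul]
    exact Nat.mul_le_mul_right _ (by omega)
  have hG : ∀ i, (G i).natDegree ≤ (i - 1) * k := fun i =>
    natDegree_sum_le_of_forall_le _ _ fun j hj => hterm i j (Finset.mem_range.1 hj)
  have hGD : (G D).coeff ((D - 1) * k) = D * g₁.leadingCoeff ^ (D - 1) := by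
    simp only [G, finsetSum_coeff]
    rw [Finset.sum_congr rfl (g := fun _ => g₁.leadingCoeff ^ (D - 1))]
    · simp
    · intro j hj
      rw [Finset.mem_range] at hj
      have e : (D - 1) * k = j * k + (D - 1 - j) * k := by
        rw [← add_mul]; congr 1; omega
      rw [e, coeff_mul_add_eq_of_natDegree_le (by rw [natDegree_pow])
        (by rw [natDegree_pow, ← hdeg]),
        coeff_pow_of_natDegree_le le_rfl, hdeg, coeff_pow_of_natDegree_le le_rfl, ← hdeg]
      change g₁.leadingCoeff ^ j * _ = _
      rw [hdeg]
      change _ * g₂.leadingCoeff ^ _ = _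
      rw [← hlead, ← pow_add]
      congr 1
      omega
  have hQc : Q.coeff ((D - 1) * k) ≠ 0 := by
    have : Q.coeff ((D - 1) * k) = f.leadingCoeff * (D * g₁.leadingCoeff ^ (D - 1)) := by
      simp only [Q, finsetSum_coeff, coeff_C_mul]
      rw [Finset.sum_range_succ, hGD, Finset.sum_eq_zero, zero_add]
      · rfl
      · intro i hi
        rw [Finset.mem_range] at hi
        rw [coeff_eq_zero_of_natDegree_lt (p := G i), mul_zero]
        refine (hG i).trans_lt ?_
        exact Nat.mul_lt_mul_of_pos_right (by omega) hpos
    rw [this]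
    have hf0 : f.leadingCoeff ≠ 0 := leadingCoeff_ne_zero.2 (by rintro rfl; simp at hD; omega)
    have hg0 : g₁.leadingCoeff ≠ 0 := leadingCoeff_ne_zero.2 (by rintro rfl; simp at hk; omega)
    have : (D : F) ≠ 0 := by exact_mod_cast (show D ≠ 0 by omega)
    positivity
  have hQ0 : Q ≠ 0 := by rintro h; rw [h] at hQc; simp at hQc
  have h3 := congrArg natDegree hQ
  rw [natDegree_comp, natDegree_mul hQ0 hE0, ← hD] at h3
  have h4 := le_natDegree_of_ne_zero hQc
  have h5 : (D - 1) * E.natDegree < (D - 1) * k :=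
    Nat.mul_lt_mul_of_pos_left hEdeg (by omega)
  obtain ⟨d, hd⟩ : ∃ d, D = d + 1 := ⟨D - 1, by omega⟩
  rw [hd] at h3 h4 h5
  simp only [Nat.add_sub_cancel] at h4 h5
  nlinarith

theorem leadingCoeff_polIter {f : F[X]} (hf : 0 < f.natDegree) (k : ℕ) :
    (polIter f k).leadingCoeff =
      f.leadingCoeff ^ (∑ j ∈ Finset.range k, f.natDegree ^ j) := by
  induction k with
  | zero => simp [polIter]
  | succ k ih =>
    rw [polIter_succ_right, leadingCoeff_comp hf.ne', ih, natDegree_polIter,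
      Finset.sum_range_succ, pow_add]

/-- Two nonconstant polynomials commuting with a common nonlinear polynomial satisfy an
Ore-type relation. -/
theorem exists_ore_relation [CharZero F] {f g h : F[X]} (hf : 2 ≤ f.natDegree)
    (hg : PolyCommute f g) (hh : PolyCommute f h) (hg0 : 0 < g.natDegree)
    (hh0 : 0 < h.natDegree) :
    ∃ a b : F[X], 0 < a.natDegree ∧ 0 < b.natDegree ∧ a.comp h = b.comp g := by
  set A := g.comp h with hA
  set B := h.comp g with hB
  have hA0 : 0 < A.natDegree := natDegree_comp_pos hg0 hh0
  have hB0 : 0 < B.natDegree := natDegree_comp_pos hh0 hg0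
  have hAB : A.natDegree = B.natDegree := by rw [hA, hB, natDegree_comp, natDegree_comp, mul_comm]
  have hfA : PolyCommute f A := hg.comp_right hh
  have hfB : PolyCommute f B := hh.comp_right hg
  have hlead : B.leadingCoeff ^ (f.natDegree - 1) = A.leadingCoeff ^ (f.natDegree - 1) := by
    rw [hfA.leadingCoeff hf hA0, hfB.leadingCoeff hf hB0, hAB]
  set k := A.natDegree with hk
  let s : ℕ → ℕ := fun l => ∑ j ∈ Finset.range l, k ^ j
  obtain ⟨i, l, hl, hdvd⟩ : ∃ i l, 1 ≤ l ∧ (f.natDegree - 1) ∣ s l * k ^ i := by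
    have : NeZero (f.natDegree - 1) := ⟨by omega⟩
    obtain ⟨i, j, hij, hs⟩ := Finite.exists_ne_map_eq_of_infinite
      (fun l => (s l : ZMod (f.natDegree - 1)))
    wlog hlt : i < j generalizing i j
    · exact this j i hij.symm hs.symm (by omega)
    refine ⟨i, j - i, by omega, ?_⟩
    have e : s j = s i + s (j - i) * k ^ i := by
      simp only [s]
      conv_lhs => rw [show j = i + (j - i) by omega]
      rw [Finset.sum_range_add, Finset.sum_mul]
      congr 1
      refine Finset.sum_congr rfl fun x _ => ?_
      rw [pow_add, mul_comm]
    simp only [e] at hs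
    rw [← CharP.cast_eq_zero_iff (ZMod (f.natDegree - 1))]
    push_cast at hs ⊢
    simpa using hs.symm
  have hl' : l = (l - 1) + 1 := by omega
  have key : (polIter A i).comp (polIter A l) = (polIter A i).comp (polIter B l) := by
    refine PolyCommute.unique hf ((hfA.iter_right i).comp_right (hfA.iter_right l))
      ((hfA.iter_right i).comp_right (hfB.iter_right l))
      (natDegree_comp_pos (natDegree_polIter_pos hA0 _) (natDegree_polIter_pos hA0 _)) ?_ ?_
    · simp only [natDegree_comp, natDegree_polIter]
      rw [← hk, hAB]
    · rw [leadingCoeff_comp (natDegree_polIter_pos hA0 _).ne',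
        leadingCoeff_comp (natDegree_polIter_pos hB0 _).ne', natDegree_polIter,
        leadingCoeff_polIter hA0 l, leadingCoeff_polIter hB0 l, ← hAB, ← pow_mul, ← pow_mul]
      obtain ⟨c, hc⟩ := hdvd
      simp only [s] at hc
      rw [hc, pow_mul, pow_mul, hlead]
  refine ⟨(polIter A i).comp ((polIter A (l - 1)).comp g),
    (polIter A i).comp ((polIter B (l - 1)).comp h),
    natDegree_comp_pos (natDegree_polIter_pos hA0 _)
      (natDegree_comp_pos (natDegree_polIter_pos hA0 _) hg0),
    natDegree_comp_pos (natDegree_polIter_pos hA0 _)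
      (natDegree_comp_pos (natDegree_polIter_pos hB0 _) hh0), ?_⟩
  rw [hl', polIter_succ_right, polIter_succ_right] at key
  simpa only [hA, hB, comp_assoc] using key

end Iterates

section Valued

variable {F Ω Γ : Type} [Field F] [Field Ω] [Algebra F Ω] [LinearOrderedCommGroupWithZero Γ]

/-- `u` and `w` agree to leading order for the valuation `v`. -/
def Asymp (v : Valuation Ω Γ) (u w : Ω) : Prop := v (u - w) < v w

variable {v : Valuation Ω Γ}

theorem Asymp.val_eq {u w : Ω} (h : Asymp v u w) : v u = v w :=
  Valuation.map_eq_of_sub_lt v h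

theorem Asymp.ne_zero {u w : Ω} (h : Asymp v u w) : w ≠ 0 := by
  rintro rfl
  simp [Asymp] at h

theorem Asymp.refl {w : Ω} (h : w ≠ 0) : Asymp v w w := by
  simpa [Asymp, zero_lt_iff] using h

theorem Asymp.symm {u w : Ω} (h : Asymp v u w) : Asymp v w u := by
  unfold Asymp
  rw [h.val_eq, Valuation.map_sub_swap]
  exact h

theorem Asymp.trans {u w z : Ω} (h : Asymp v u w) (h' : Asymp v w z) : Asymp v u z := by
  unfold Asymp
  rw [← sub_add_sub_cancel u w z]
  exact Valuation.map_add_lt v (by rw [← h'.val_eq]; exact h) h'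

theorem Asymp.mul {u w u' w' : Ω} (h : Asymp v u w) (h' : Asymp v u' w') :
    Asymp v (u * u') (w * w') := by
  have hw : 0 < v w := zero_lt_iff.2 ((Valuation.ne_zero_iff v).2 h.ne_zero)
  have hw' : 0 < v w' := zero_lt_iff.2 ((Valuation.ne_zero_iff v).2 h'.ne_zero)
  unfold Asymp
  rw [show u * u' - w * w' = (u - w) * u' + w * (u' - w') by ring, map_mul]
  refine Valuation.map_add_lt v ?_ ?_
  · rw [map_mul, h'.val_eq]
    exact mul_lt_mul_of_pos_right h hw'
  · rw [map_mul]
    exact mul_lt_mul_of_pos_left h' hw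

theorem Asymp.pow {u w : Ω} (h : Asymp v u w) (n : ℕ) : Asymp v (u ^ n) (w ^ n) := by
  induction n with
  | zero => simpa using Asymp.refl (v := v) one_ne_zero
  | succ n ih => rw [pow_succ, pow_succ]; exact ih.mul h

/-- `v` is trivial on the constants `F`. -/
def TrivOn (F : Type) [Field F] [Algebra F Ω] (v : Valuation Ω Γ) : Prop :=
  ∀ c : F, c ≠ 0 → v (algebraMap F Ω c) = 1

theorem TrivOn.le_one (hv : TrivOn F v) (c : F) : v (algebraMap F Ω c) ≤ 1 := by
  by_cases h : c = 0
  · simp [h]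
  · rw [hv c h]

theorem TrivOn.eq_of_asymp (hv : TrivOn F v) {c e : F} {w : Ω}
    (h : Asymp v (algebraMap F Ω c * w) (algebraMap F Ω e * w)) : c = e := by
  by_contra hne
  have hw : w ≠ 0 := by rintro rfl; simp [Asymp] at h
  have hw0 : 0 < v w := zero_lt_iff.2 ((Valuation.ne_zero_iff v).2 hw)
  unfold Asymp at h
  rw [← sub_mul, ← map_sub, map_mul, map_mul, hv _ (sub_ne_zero.2 hne), one_mul] at h
  have := mul_le_mul_left (hv.le_one e) (v w)
  rw [one_mul] at this
  exact absurd h (not_lt.2 this)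

theorem TrivOn.asymp_aeval (hv : TrivOn F v) {p : F[X]} (hp : p ≠ 0) {U : Ω} (hU : 1 < v U) :
    Asymp v (aeval U p) (algebraMap F Ω p.leadingCoeff * U ^ p.natDegree) := by
  have hU0 : U ≠ 0 := by rintro rfl; simp at hU
  unfold Asymp
  rw [aeval_eq_sum_range, Finset.sum_range_succ, Algebra.smul_def (p.coeff p.natDegree),
    ← leadingCoeff, add_sub_cancel_right, map_mul, hv _ (leadingCoeff_ne_zero.2 hp), one_mul,
    map_pow]
  refine Valuation.map_sum_lt v (pow_ne_zero _ (by simpa using hU0)) fun i hi => ?_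
  rw [Finset.mem_range] at hi
  rw [Algebra.smul_def, map_mul, map_pow]
  calc _ ≤ 1 * v U ^ i := mul_le_mul_left (hv.le_one _) _
    _ < _ := by rw [one_mul]; exact pow_lt_pow_right₀ hU hi

theorem TrivOn.val_aeval (hv : TrivOn F v) {p : F[X]} (hp : p ≠ 0) {U : Ω} (hU : 1 < v U) :
    v (aeval U p) = v U ^ p.natDegree := by
  rw [(hv.asymp_aeval hp hU).val_eq, map_mul, hv _ (leadingCoeff_ne_zero.2 hp), one_mul, map_pow]

theorem TrivOn.val_aeval_le (hv : TrivOn F v) (p : F[X]) {U : Ω} (hU : v U ≤ 1) :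
    v (aeval U p) ≤ 1 := by
  rw [aeval_eq_sum_range]
  refine Valuation.map_sum_le v fun i _ => ?_
  rw [Algebra.smul_def, map_mul, map_pow]
  exact mul_le_one' (hv.le_one _) (pow_le_one' hU _)

/-- A polynomial in characteristic zero is injective on each asymptotic class near infinity. -/
theorem TrivOn.rigid [CharZero F] (hv : TrivOn F v) {p : F[X]} (hp : 0 < p.natDegree) {U V : Ω}
    (hV : 1 < v V) (hUV : Asymp v U V) (h : aeval U p = aeval V p) : U = V := by
  by_contra hne
  set N := p.natDegree with hN
  let G : ℕ → Ω := fun i => ∑ j ∈ Finset.range i, U ^ j * V ^ (i - 1 - j)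
  let Q : Ω := ∑ i ∈ Finset.range (N + 1), algebraMap F Ω (p.coeff i) * G i
  have hV0 : V ≠ 0 := hUV.ne_zero
  have hvV : v V ≠ 0 := by simpa using hV0
  have hQ : Q * (U - V) = 0 := by
    rw [Finset.sum_mul, ← sub_eq_zero.2 h, aeval_eq_sum_range, aeval_eq_sum_range,
      ← Finset.sum_sub_distrib]
    refine Finset.sum_congr rfl fun i _ => ?_
    rw [mul_assoc, geom_sum₂_mul, ← smul_sub, Algebra.smul_def]
  have hQ0 : Q = 0 := (mul_eq_zero.1 hQ).resolve_right (sub_ne_zero.2 hne)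
  have hterm : ∀ i j, j < i → Asymp v (U ^ j * V ^ (i - 1 - j)) (V ^ (i - 1)) := by
    intro i j hj
    have := (hUV.pow j).mul (Asymp.refl (v := v) (pow_ne_zero (i - 1 - j) hV0))
    rwa [← pow_add, show j + (i - 1 - j) = i - 1 by omega] at this
  have hG : ∀ i, v (G i) ≤ v V ^ (i - 1) := fun i =>
    Valuation.map_sum_le v fun j hj => by
      rw [(hterm i j (Finset.mem_range.1 hj)).val_eq, map_pow]
  have hGN : v (G N - N * V ^ (N - 1)) < v V ^ (N - 1) := by
    have : G N - N * V ^ (N - 1) =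
        ∑ j ∈ Finset.range N, (U ^ j * V ^ (N - 1 - j) - V ^ (N - 1)) := by
      simp [G, Finset.sum_sub_distrib]
    rw [this]
    refine Valuation.map_sum_lt v (pow_ne_zero _ hvV) fun j hj => ?_
    rw [← map_pow]
    exact hterm N j (Finset.mem_range.1 hj)
  have hlead : p.leadingCoeff ≠ 0 := leadingCoeff_ne_zero.2 (by rintro rfl; simp at hN; omega)
  have hNF : (N : F) ≠ 0 := by exact_mod_cast hp.ne'
  have hmain : v (Q - algebraMap F Ω (p.leadingCoeff * N) * V ^ (N - 1)) < v V ^ (N - 1) := by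
    have : Q - algebraMap F Ω (p.leadingCoeff * N) * V ^ (N - 1) =
        ∑ i ∈ Finset.range N, algebraMap F Ω (p.coeff i) * G i +
          algebraMap F Ω p.leadingCoeff * (G N - N * V ^ (N - 1)) := by
      simp only [Q]
      rw [Finset.sum_range_succ, map_mul, map_natCast, leadingCoeff, ← hN]
      ring
    rw [this]
    refine Valuation.map_add_lt v (Valuation.map_sum_lt v (pow_ne_zero _ hvV) fun i hi => ?_) ?_
    · rw [Finset.mem_range] at hi
      rw [map_mul]
      rcases Nat.eq_zero_or_pos i with rfl | hi0
      · rw [show G 0 = 0 by simp [G], map_zero, mul_zero]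
        exact zero_lt_iff.2 (pow_ne_zero _ hvV)
      · calc _ ≤ 1 * v V ^ (i - 1) := mul_le_mul' (hv.le_one _) (hG i)
          _ < _ := by rw [one_mul]; exact pow_lt_pow_right₀ hV (by omega)
    · rwa [map_mul, hv _ hlead, one_mul]
  rw [hQ0, zero_sub, Valuation.map_neg, map_mul, hv _ (mul_ne_zero hlead hNF), one_mul, map_pow]
    at hmain
  exact lt_irrefl _ hmain

theorem TrivOn.one_lt_of_aeval_eq (hv : TrivOn F v) {h : F[X]} (hh : 0 < h.natDegree) {x τ : Ω}
    (hx : 1 < v x) (hτ : aeval τ h = aeval x h) : 1 < v τ := by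
  by_contra hle
  have h1 := hv.val_aeval_le h (not_lt.1 hle)
  rw [hτ, hv.val_aeval (by rintro rfl; simp at hh) hx] at h1
  exact absurd (one_lt_pow₀ hx hh.ne') (not_lt.2 h1)

/-- Solutions `τ` of `h(τ) = h(x)` are asymptotic to `ζ x` with `ζ` a root of unity. -/
theorem TrivOn.exists_root_asymp [IsAlgClosed F] [CharZero F] (hv : TrivOn F v) {h : F[X]}
    (hh : 0 < h.natDegree) {x τ : Ω} (hx : 1 < v x) (hτ : aeval τ h = aeval x h) :
    ∃ ζ : F, ζ ^ h.natDegree = 1 ∧ Asymp v τ (algebraMap F Ω ζ * x) := by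
  set n := h.natDegree with hn
  have hh0 : h ≠ 0 := by rintro rfl; simp at hn; omega
  have hx0 : x ≠ 0 := by rintro rfl; simp at hx
  have hτ1 := hv.one_lt_of_aeval_eq hh hx hτ
  have h1 := (hv.asymp_aeval hh0 hτ1).symm.trans (hτ ▸ hv.asymp_aeval hh0 hx)
  rw [← hn] at h1
  have h2 : Asymp v (τ ^ n) (x ^ n) := by
    have hc : algebraMap F Ω h.leadingCoeff ≠ 0 := by simpa using hh0
    have := (Asymp.refl (v := v) (inv_ne_zero hc)).mul h1
    rwa [inv_mul_cancel_left₀ hc, inv_mul_cancel_left₀ hc] at this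
  have : NeZero n := ⟨hh.ne'⟩
  have : NeZero (n : F) := ⟨by exact_mod_cast hh.ne'⟩
  obtain ⟨ζ, hζ⟩ := HasEnoughRootsOfUnity.exists_primitiveRoot F n
  have hprod : τ ^ n - x ^ n =
      ∏ ζ ∈ nthRootsFinset n (1 : F), (τ - algebraMap F Ω ζ * x) := by
    have e := congrArg (fun p => aeval (τ / x) p) (X_pow_sub_one_eq_prod hh hζ)
    simp only [map_sub, map_pow, aeval_X, map_one, map_prod, aeval_C] at e
    have e2 : τ ^ n - x ^ n = x ^ n * ((τ / x) ^ n - 1) := by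
      rw [div_pow]; field_simp
    have hcard : (nthRootsFinset n (1 : F)).card = n := hζ.card_nthRootsFinset
    rw [e2, e, ← hcard, ← Finset.prod_const, hcard, ← Finset.prod_mul_distrib]
    refine Finset.prod_congr rfl fun ζ _ => ?_
    field_simp
  have hcard : (nthRootsFinset n (1 : F)).card = n := hζ.card_nthRootsFinset
  by_contra hcon
  have hle : ∀ ξ ∈ nthRootsFinset n (1 : F), v x ≤ v (τ - algebraMap F Ω ξ * x) := by
    intro ξ hξ
    rw [mem_nthRootsFinset hh] at hξ
    by_contra hlt
    refine hcon ⟨ξ, hξ, ?_⟩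
    have hξ0 : ξ ≠ 0 := by rintro rfl; simp [hh.ne'] at hξ
    unfold Asymp
    rw [map_mul, hv _ hξ0, one_mul]
    exact not_le.1 hlt
  have h3 : v x ^ n ≤ v (τ ^ n - x ^ n) := by
    rw [hprod, map_prod, ← hcard, ← Finset.prod_const, hcard]
    exact Finset.prod_le_prod' hle
  unfold Asymp at h2
  rw [map_pow] at h2
  exact absurd h2 (not_lt.2 h3)

/-- Every direction `ζ x` with `ζ ^ deg h = 1` carries a solution of `h(σ) = h(x)`. -/
theorem TrivOn.exists_solution [IsAlgClosed Ω] (hv : TrivOn F v) {h : F[X]}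
    (hh : 0 < h.natDegree) {x : Ω} (hx : 1 < v x) {ζ : F} (hζ : ζ ^ h.natDegree = 1) :
    ∃ σ : Ω, aeval σ h = aeval x h ∧ Asymp v σ (algebraMap F Ω ζ * x) := by
  set n := h.natDegree with hn
  have hh0 : h ≠ 0 := by rintro rfl; simp at hn; omega
  have hζ0 : ζ ≠ 0 := by rintro rfl; simp [hh.ne'] at hζ
  have hvζ : v (algebraMap F Ω ζ * x) = v x := by rw [map_mul, hv _ hζ0, one_mul]
  let q : Polynomial Ω := h.map (algebraMap F Ω) - C (aeval x h)
  have hqdeg : q.natDegree = n := by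
    simp only [q]; rw [natDegree_sub_C, natDegree_map]
  have hq0 : q ≠ 0 := by rintro e; rw [e] at hqdeg; simp at hqdeg; omega
  have hqlead : q.leadingCoeff = algebraMap F Ω h.leadingCoeff := by
    rw [leadingCoeff, hqdeg]
    simp only [q]
    rw [coeff_sub, coeff_C_of_ne_zero hh.ne', sub_zero, coeff_map]
    rfl
  have hsplit := (IsAlgClosed.splits q).eq_prod_roots
  have hcard := (IsAlgClosed.splits q).natDegree_eq_card_roots
  have heval : q.eval (algebraMap F Ω ζ * x) =
      algebraMap F Ω h.leadingCoeff *
        (q.roots.map fun σ => algebraMap F Ω ζ * x - σ).prod := by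
    conv_lhs => rw [hsplit]
    rw [eval_mul, eval_C, hqlead, eval_multiset_prod, Multiset.map_map]
    simp
  have hsmall : v (q.eval (algebraMap F Ω ζ * x)) < v x ^ n := by
    have h1 := hv.asymp_aeval hh0 (U := algebraMap F Ω ζ * x) (by rwa [hvζ])
    rw [← hn, mul_pow, ← map_pow, hζ, map_one, one_mul] at h1
    have h2 := h1.trans (hv.asymp_aeval hh0 hx).symm
    have h3 : q.eval (algebraMap F Ω ζ * x) =
        aeval (algebraMap F Ω ζ * x) h - aeval x h := by
      simp [q, aeval_def, eval_map]
    rw [h3, ← hv.val_aeval hh0 hx]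
    exact h2
  by_contra hcon
  have hle : ∀ s : Multiset Ω, (∀ σ ∈ s, v x ≤ v (algebraMap F Ω ζ * x - σ)) →
      v x ^ s.card ≤ v (s.map fun σ => algebraMap F Ω ζ * x - σ).prod := by
    intro s
    induction s using Multiset.induction_on with
    | empty => simp
    | cons a s ih =>
      intro hs
      rw [Multiset.map_cons, Multiset.prod_cons, Multiset.card_cons, pow_succ', map_mul]
      exact mul_le_mul' (hs a (Multiset.mem_cons_self _ _))
        (ih fun σ hσ => hs σ (Multiset.mem_cons_of_mem hσ))
  rw [heval, map_mul, hv _ (leadingCoeff_ne_zero.2 hh0), one_mul, ← hqdeg, hcard] at hsmall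
  refine absurd hsmall (not_lt.2 (hle _ fun σ hσ => ?_))
  by_contra hlt
  refine hcon ⟨σ, ?_, ?_⟩
  · have := (mem_roots hq0).1 hσ
    simpa [q, IsRoot, sub_eq_zero, aeval_def, eval_map] using this
  · unfold Asymp
    rw [Valuation.map_sub_swap, hvζ]
    exact not_le.1 hlt

/-- An algebraically closed extension of `F` with a place at infinity. -/
theorem exists_place_at_infinity (F : Type) [Field F] :
    ∃ (Ω : Type) (_ : Field Ω) (_ : Algebra F Ω) (_ : IsAlgClosed Ω)
      (Γ : Type) (_ : LinearOrderedCommGroupWithZero Γ) (v : Valuation Ω Γ) (x : Ω),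
      TrivOn F v ∧ 1 < v x := by
  let Ω := AlgebraicClosure (FractionRing F[X])
  let y : Ω := algebraMap F[X] Ω X
  have hinj : Function.Injective (algebraMap F[X] Ω) := by
    rw [IsScalarTower.algebraMap_eq F[X] (FractionRing F[X]) Ω]
    exact (algebraMap (FractionRing F[X]) Ω).injective.comp (IsFractionRing.injective _ _)
  let A : Subring Ω := (algebraMap F[X] Ω).range
  let yA : A := ⟨y, X, rfl⟩
  have hI : Ideal.span {yA} ≠ ⊤ := by
    rw [Ne, Ideal.span_singleton_eq_top]
    intro hu
    obtain ⟨⟨z, p, hp⟩, hz⟩ := hu.exists_right_inv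
    have h1 : y * z = 1 := congrArg Subtype.val hz
    have h2 : (X * p : F[X]) = 1 := hinj (by rw [map_mul, hp, map_one]; exact h1)
    exact not_isUnit_X (IsUnit.of_mul_eq_one _ h2)
  obtain ⟨B, hAB, hIB⟩ := Ideal.image_subset_nonunits_valuationSubring (Ideal.span {yA}) hI
  have hy : B.valuation y < 1 := by
    rw [← ValuationSubring.mem_nonunits_iff]
    exact hIB ⟨yA, Ideal.subset_span rfl, rfl⟩
  have hy0 : y ≠ 0 := by
    intro h
    exact X_ne_zero (hinj (h.trans (map_zero _).symm))
  have hle : ∀ c : F, B.valuation (algebraMap F Ω c) ≤ 1 := by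
    intro c
    rw [ValuationSubring.valuation_le_one_iff]
    refine hAB ⟨C c, ?_⟩
    rw [IsScalarTower.algebraMap_apply F F[X] Ω]
    rfl
  refine ⟨Ω, inferInstance, inferInstance, inferInstance, _, inferInstance, B.valuation, y⁻¹,
    fun c hc => le_antisymm (hle c) ?_, ?_⟩
  · have h1 := hle c⁻¹
    rw [map_inv₀, map_inv₀] at h1
    exact (inv_le_one₀ (zero_lt_iff.2 (by simpa using hc))).1 h1
  · rw [map_inv₀]
    exact (one_lt_inv₀ (zero_lt_iff.2 (by simpa using hy0))).2 hy

end Valued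

section Engstrom

variable {F : Type} [Field F]

section Core

variable {Ω Γ : Type} [Field Ω] [Algebra F Ω] [LinearOrderedCommGroupWithZero Γ]
  {v : Valuation Ω Γ}

theorem TrivOn.aeval_injective (hv : TrivOn F v) {U : Ω} (hU : 1 < v U) :
    Function.Injective (aeval U : F[X] →ₐ[F] Ω) := by
  rw [injective_iff_map_eq_zero]
  intro p hp
  by_contra hne
  have h1 := hv.val_aeval hne hU
  rw [hp, map_zero] at h1
  exact pow_ne_zero _ (zero_lt_one.trans hU).ne' h1.symm

theorem TrivOn.rigid_of_comp [CharZero F] (hv : TrivOn F v) {a g b h : F[X]}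
    (ha : 0 < a.natDegree) (hg : 0 < g.natDegree) (hab : a.comp g = b.comp h) {x σ : Ω} {ζ : F}
    (hx : 1 < v x) (hσ : aeval σ h = aeval x h) (hσζ : Asymp v σ (algebraMap F Ω ζ * x))
    (hζ : ζ ^ g.natDegree = 1) : aeval σ g = aeval x g := by
  have hg0 : g ≠ 0 := by rintro rfl; simp at hg
  have hζ0 : ζ ≠ 0 := by rintro rfl; simp [hg.ne'] at hζ
  have hσv : v σ = v x := by rw [hσζ.val_eq, map_mul, hv _ hζ0, one_mul]
  have h1 : Asymp v (σ ^ g.natDegree) (x ^ g.natDegree) := by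
    have := hσζ.pow g.natDegree
    rwa [mul_pow, ← map_pow, hζ, map_one, one_mul] at this
  have h2 : Asymp v (aeval σ g) (aeval x g) := by
    refine (hv.asymp_aeval hg0 (by rwa [hσv])).trans (Asymp.trans ?_ (hv.asymp_aeval hg0 hx).symm)
    exact (Asymp.refl (by simpa using hg0)).mul h1
  refine hv.rigid ha (V := aeval x g) ?_ h2 ?_
  · rw [hv.val_aeval hg0 hx]; exact one_lt_pow₀ hx hg.ne'
  · rw [← aeval_comp, ← aeval_comp, hab, aeval_comp, aeval_comp, hσ]

theorem TrivOn.dvd_natDegree (hv : TrivOn F v) {x σ : Ω} {ζ : F} {d : ℕ}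
    (hζ : IsPrimitiveRoot ζ d) (hd : 0 < d) (hx : 1 < v x)
    (hσζ : Asymp v σ (algebraMap F Ω ζ * x)) {s : F[X]} (hs : aeval σ s = aeval x s) :
    d ∣ s.natDegree := by
  rcases eq_or_ne s 0 with rfl | hs0
  · simp
  have hζ0 : ζ ≠ 0 := hζ.ne_zero hd.ne'
  have hσv : v σ = v x := by rw [hσζ.val_eq, map_mul, hv _ hζ0, one_mul]
  have h1 := (hv.asymp_aeval hs0 (by rwa [hσv] : 1 < v σ)).symm.trans
    (hs ▸ hv.asymp_aeval hs0 hx)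
  have hc : algebraMap F Ω s.leadingCoeff ≠ 0 := by simpa using hs0
  have h2 := (Asymp.refl (v := v) (inv_ne_zero hc)).mul h1
  rw [inv_mul_cancel_left₀ hc, inv_mul_cancel_left₀ hc] at h2
  have h3 := (hσζ.pow s.natDegree).symm.trans h2
  rw [mul_pow, ← map_pow] at h3
  refine hζ.dvd_of_pow_eq_one _ (hv.eq_of_asymp (w := x ^ s.natDegree) ?_)
  rwa [map_one, one_mul]

/-- The polynomials taking the same value at `x` and `σ` contain one of degree at most `d`,
where `d` is the gcd of two degrees of such polynomials. -/
theorem TrivOn.exists_generator [IsAlgClosed F] [CharZero F] [IsAlgClosed Ω] (hv : TrivOn F v)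
    {g h : F[X]} (hg : 0 < g.natDegree) (hh : 0 < h.natDegree) {x σ : Ω} (hx : 1 < v x)
    (hgσ : aeval σ g = aeval x g) (hhσ : aeval σ h = aeval x h) :
    ∃ r : F[X], 0 < r.natDegree ∧ r.natDegree ≤ g.natDegree.gcd h.natDegree ∧
      aeval σ r = aeval x r := by
  classical
  have hσ1 : 1 < v σ := hv.one_lt_of_aeval_eq hg hx hgσ
  let E := FractionRing F[X]
  let ψ₁ : E →+* Ω := IsFractionRing.lift (g := (aeval x : F[X] →ₐ[F] Ω).toRingHom)
    (hv.aeval_injective hx)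
  let ψ₂ : E →+* Ω := IsFractionRing.lift (g := (aeval σ : F[X] →ₐ[F] Ω).toRingHom)
    (hv.aeval_injective hσ1)
  have hψ₁ : ∀ p : F[X], ψ₁ (algebraMap F[X] E p) = aeval x p := fun p =>
    IsFractionRing.lift_algebraMap _ p
  have hψ₂ : ∀ p : F[X], ψ₂ (algebraMap F[X] E p) = aeval σ p := fun p =>
    IsFractionRing.lift_algebraMap _ p
  let L : Subfield E := RingHom.eqLocusField ψ₁ ψ₂
  have hL : ∀ e : E, e ∈ L ↔ ψ₁ e = ψ₂ e := fun e => Iff.rfl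
  have hmem : ∀ {p : F[X]}, aeval σ p = aeval x p → algebraMap F[X] E p ∈ L := by
    intro p hp
    rw [hL, hψ₁, hψ₂, hp]
  let ι : F →+* L := ((algebraMap F[X] E).comp C).codRestrict L fun c => hmem (by simp)
  have hιE : L.subtype.comp ι = (algebraMap F[X] E).comp C := by ext c; rfl
  have hιΩ : (ψ₁.comp L.subtype).comp ι = algebraMap F Ω := by
    rw [RingHom.comp_assoc, hιE]
    ext c
    simp [hψ₁]
  let P : (p : F[X]) → aeval σ p = aeval x p → L[X] := fun p hp =>
    p.map ι - C ⟨algebraMap F[X] E p, hmem hp⟩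
  have hPdeg : ∀ (p : F[X]) hp, (P p hp).natDegree = p.natDegree := fun p hp => by
    simp only [P]; rw [natDegree_sub_C, natDegree_map]
  have hProot : ∀ (p : F[X]) hp, aeval (algebraMap F[X] E X) (P p hp) = 0 := by
    intro p hp
    have h1 : (aeval (algebraMap F[X] E X)) (p.map ι) = algebraMap F[X] E p := by
      rw [aeval_def, eval₂_map]
      change eval₂ (L.subtype.comp ι) _ p = _
      rw [hιE, ← hom_eval₂, eval₂_C_X]
    simp only [P]
    rw [map_sub, h1, aeval_C]
    exact sub_self _
  have hint : IsIntegral L (algebraMap F[X] E X) := by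
    rw [← isAlgebraic_iff_isIntegral]
    refine ⟨P g hgσ, ?_, hProot g hgσ⟩
    rintro h0
    have := hPdeg g hgσ
    rw [h0] at this
    simp at this
    omega
  set Φ := minpoly L (algebraMap F[X] E X) with hΦ
  have hΦmonic : Φ.Monic := minpoly.monic hint
  let ΦΩ : Polynomial Ω := Φ.map (ψ₁.comp L.subtype)
  have hΦΩmonic : ΦΩ.Monic := hΦmonic.map _
  have hΦΩdeg : ΦΩ.natDegree = Φ.natDegree := natDegree_map _
  have hnodup : ΦΩ.roots.Nodup :=
    nodup_roots ((minpoly.irreducible hint).separable.map)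
  have hcard : Φ.natDegree = ΦΩ.roots.card := by
    rw [← hΦΩdeg, (IsAlgClosed.splits ΦΩ).natDegree_eq_card_roots]
  have hroot : ∀ p : F[X], aeval σ p = aeval x p → ∀ τ ∈ ΦΩ.roots, aeval τ p = aeval x p := by
    intro p hp τ hτ
    have h1 : ΦΩ ∣ (P p hp).map (ψ₁.comp L.subtype) :=
      Polynomial.map_dvd _ (minpoly.dvd L _ (hProot p hp))
    have h2 : ((P p hp).map (ψ₁.comp L.subtype)).eval τ = 0 :=
      eval_eq_zero_of_dvd_of_eval_eq_zero h1 (isRoot_of_mem_roots hτ)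
    simp only [P] at h2
    rw [Polynomial.map_sub, Polynomial.map_map, hιΩ, map_C, eval_sub, eval_C, sub_eq_zero,
      eval_map_algebraMap] at h2
    rw [h2]
    exact hψ₁ p
  have hζ : ∀ τ ∈ ΦΩ.roots, ∃ ζ : F, ζ ^ (g.natDegree.gcd h.natDegree) = 1 ∧
      Asymp v τ (algebraMap F Ω ζ * x) := by
    intro τ hτ
    obtain ⟨ζ, h1, h2⟩ := hv.exists_root_asymp hg hx (hroot g hgσ τ hτ)
    obtain ⟨ζ', h1', h2'⟩ := hv.exists_root_asymp hh hx (hroot h hhσ τ hτ)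
    obtain rfl := hv.eq_of_asymp (h2.symm.trans h2')
    exact ⟨ζ, pow_gcd_eq_one.2 ⟨h1, h1'⟩, h2⟩
  choose! ζ hζ1 hζ2 using hζ
  have hd : 0 < g.natDegree.gcd h.natDegree := Nat.gcd_pos_of_pos_left _ hg
  have hΦle : Φ.natDegree ≤ g.natDegree.gcd h.natDegree := by
    rw [hcard, ← Multiset.toFinset_card_of_nodup hnodup]
    calc _ ≤ (nthRootsFinset (g.natDegree.gcd h.natDegree) (1 : F)).card := by
          refine Finset.card_le_card_of_injOn ζ ?_ ?_
          · intro τ hτ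
            have hτ := Multiset.mem_toFinset.1 hτ
            exact (mem_nthRootsFinset hd _).2 (hζ1 τ hτ)
          · intro τ hτ τ' hτ' he
            have hτ := Multiset.mem_toFinset.1 hτ
            have hτ' := Multiset.mem_toFinset.1 hτ'
            refine hv.rigid hg
              (hv.one_lt_of_aeval_eq hg hx (hroot g hgσ τ' hτ')) ?_
              ((hroot g hgσ τ hτ).trans (hroot g hgσ τ' hτ').symm)
            have := hζ2 τ hτ
            rw [he] at this
            exact this.trans (hζ2 τ' hτ').symm
      _ ≤ _ := by
          rw [nthRootsFinset_def]
          exact (Multiset.toFinset_card_le _).trans (card_nthRoots _ _)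
  have hτv : ∀ τ ∈ ΦΩ.roots, v τ = v x := by
    intro τ hτ
    have h0 : ζ τ ≠ 0 := by
      intro h0
      have := hζ1 τ hτ
      rw [h0, zero_pow hd.ne'] at this
      exact zero_ne_one this
    rw [(hζ2 τ hτ).val_eq, map_mul, hv _ h0, one_mul]
  have hcoeff : ψ₁ (Φ.coeff 0 : L) = (-1) ^ ΦΩ.natDegree * ΦΩ.roots.prod := by
    rw [← (IsAlgClosed.splits ΦΩ).coeff_zero_eq_prod_roots_of_monic hΦΩmonic]
    simp only [ΦΩ, coeff_map]
    rfl
  have hval : v (ψ₁ (Φ.coeff 0 : L)) = v x ^ Φ.natDegree := by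
    have : ∀ s : Multiset Ω, (∀ τ ∈ s, v τ = v x) → v s.prod = v x ^ s.card := by
      intro s
      induction s using Multiset.induction_on with
      | empty => simp
      | cons τ s ih =>
        intro hs
        rw [Multiset.prod_cons, Multiset.card_cons, pow_succ', map_mul,
          hs τ (Multiset.mem_cons_self _ _), ih fun y hy => hs y (Multiset.mem_cons_of_mem hy)]
    rw [hcoeff, map_mul, map_pow, Valuation.map_neg, map_one, one_pow, one_mul,
      this _ hτv, hcard]
  let _ : Algebra F[X] Ω := ((aeval x : F[X] →ₐ[F] Ω).toRingHom).toAlgebra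
  let _ : Algebra E Ω := ψ₁.toAlgebra
  have : IsScalarTower F[X] E Ω := IsScalarTower.of_algebraMap_eq fun p => (hψ₁ p).symm
  have hτint : ∀ τ ∈ ΦΩ.roots, IsIntegral F[X] τ := by
    intro τ hτ
    let g' := C g.leadingCoeff⁻¹ * g
    have hg0 : g ≠ 0 := by rintro rfl; simp at hg
    have hg' : g'.Monic := by
      simp only [g']; rw [mul_comm]; exact monic_mul_leadingCoeff_inv hg0
    have hg'deg : g'.natDegree = g.natDegree :=
      natDegree_C_mul (inv_ne_zero (leadingCoeff_ne_zero.2 hg0))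
    refine ⟨g'.map C - C g', ?_, ?_⟩
    · refine (hg'.map C).sub_of_left (degree_C_le.trans_lt ?_)
      rw [degree_eq_natDegree (hg'.map C).ne_zero, hg'.natDegree_map, hg'deg]
      exact_mod_cast hg
    · have h1 : (algebraMap F[X] Ω).comp C = algebraMap F Ω := by
        ext c
        exact aeval_C x c
      rw [eval₂_sub, eval₂_C, eval₂_map, h1, sub_eq_zero]
      change aeval τ g' = aeval x g'
      simp only [g', map_mul, aeval_C, hroot g hgσ τ hτ]
  have hcint : IsIntegral F[X] (Φ.coeff 0 : E) := by
    rw [← isIntegral_algebraMap_iff (algebraMap E Ω).injective]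
    change IsIntegral F[X] (ψ₁ (Φ.coeff 0 : L))
    rw [hcoeff]
    exact ((isIntegral_one.neg).pow _).mul (IsIntegral.multiset_prod hτint)
  obtain ⟨r, hr⟩ := IsIntegrallyClosed.isIntegral_iff.1 hcint
  have hrx : ψ₁ (Φ.coeff 0 : L) = aeval x r := by rw [← hr, hψ₁]
  have hr0 : r ≠ 0 := by
    rintro rfl
    rw [map_zero] at hrx
    rw [hrx, map_zero] at hval
    exact pow_ne_zero _ (zero_lt_one.trans hx).ne' hval.symm
  have hrdeg : r.natDegree = Φ.natDegree := by
    rw [hrx, hv.val_aeval hr0 hx] at hval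
    exact pow_right_injective₀ (zero_lt_one.trans hx) hx.ne' hval
  refine ⟨r, ?_, ?_, ?_⟩
  · rw [hrdeg]; exact minpoly.natDegree_pos hint
  · rwa [hrdeg]
  · have := (hL _).1 (Φ.coeff 0).2
    rw [← hr, hψ₁, hψ₂] at this
    exact this.symm

theorem exists_comp_of_forall_dvd {S : Set F[X]} {r : F[X]}
    (hdvd : ∀ s ∈ S, r.natDegree ∣ s.natDegree)
    (hr : r ≠ 0)
    (hsub : ∀ s ∈ S, ∀ c : F, ∀ j : ℕ, s - C c * r ^ j ∈ S) :
    ∀ s ∈ S, ∃ w : F[X], s = w.comp r := by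
  intro s hs
  induction hk : s.natDegree using Nat.strong_induction_on generalizing s with
  | _ k ih =>
    rcases Nat.eq_zero_or_pos k with rfl | hpos
    · rw [eq_C_of_natDegree_eq_zero hk]
      exact ⟨C (s.coeff 0), by simp⟩
    obtain ⟨j, hj⟩ := hdvd s hs
    have hs0 : s ≠ 0 := by rintro rfl; simp at hk; omega
    set c := s.leadingCoeff / r.leadingCoeff ^ j with hc
    have hrl : r.leadingCoeff ^ j ≠ 0 := pow_ne_zero _ (leadingCoeff_ne_zero.2 hr)
    have hc0 : c ≠ 0 := div_ne_zero (leadingCoeff_ne_zero.2 hs0) hrl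
    have hlt : (s - C c * r ^ j).natDegree < k := by
      have hq0 : C c * r ^ j ≠ 0 := mul_ne_zero (C_ne_zero.2 hc0) (pow_ne_zero _ hr)
      have hqd : (C c * r ^ j).natDegree = s.natDegree := by
        rw [natDegree_C_mul hc0, natDegree_pow, hj, mul_comm]
      have h1 := degree_sub_lt_left (p := s) (q := C c * r ^ j)
        (by rw [degree_eq_natDegree hs0, degree_eq_natDegree hq0, hqd]) hs0
        (by rw [leadingCoeff_mul, leadingCoeff_C, leadingCoeff_pow, hc, div_mul_cancel₀ _ hrl])
      rw [← hk]
      rcases eq_or_ne (s - C c * r ^ j) 0 with h0 | h0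
      · rw [h0, natDegree_zero, hk]
        exact hpos
      · exact natDegree_lt_natDegree h0 h1
    obtain ⟨w, hw⟩ := ih _ hlt _ (hsub s hs c j) rfl
    refine ⟨w + C c * X ^ j, ?_⟩
    rw [add_comp, mul_comp, C_comp, pow_comp, X_comp, ← hw]
    ring

end Core

/-- Engstrom's theorem: if `a ∘ g = b ∘ h`, there is a common right factor of degree
`gcd (deg g) (deg h)`. -/
theorem exists_common_right_factor [IsAlgClosed F] [CharZero F] {a g b h : F[X]}
    (ha : 0 < a.natDegree) (hg : 0 < g.natDegree) (hh : 0 < h.natDegree)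
    (hab : a.comp g = b.comp h) :
    ∃ r : F[X], r.natDegree = g.natDegree.gcd h.natDegree ∧
      ∀ s : F[X], 0 < s.natDegree → g.natDegree.gcd h.natDegree ∣ s.natDegree →
        (∃ a' b' : F[X], 0 < a'.natDegree ∧ a'.comp s = b'.comp h) →
        ∃ w : F[X], s = w.comp r := by
  obtain ⟨Ω, _, _, _, Γ, _, v, x, hv, hx⟩ := exists_place_at_infinity F
  set d := g.natDegree.gcd h.natDegree with hd
  have hd0 : 0 < d := Nat.gcd_pos_of_pos_left _ hg
  have : NeZero d := ⟨hd0.ne'⟩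
  have : NeZero (d : F) := ⟨by exact_mod_cast hd0.ne'⟩
  obtain ⟨ζ, hζ⟩ := HasEnoughRootsOfUnity.exists_primitiveRoot F d
  have hpow : ∀ {N : ℕ}, d ∣ N → ζ ^ N = 1 := fun h => (hζ.pow_eq_one_iff_dvd _).2 h
  obtain ⟨σ, hσ, hσζ⟩ := hv.exists_solution hh hx (hpow (Nat.gcd_dvd_right _ _))
  have hgσ := hv.rigid_of_comp ha hg hab hx hσ hσζ (hpow (Nat.gcd_dvd_left _ _))
  obtain ⟨r, hr0, hrle, hrσ⟩ := hv.exists_generator hg hh hx hgσ hσ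
  have hrd : r.natDegree = d :=
    le_antisymm hrle (Nat.le_of_dvd hr0 (hv.dvd_natDegree hζ hd0 hx hσζ hrσ))
  refine ⟨r, hrd, fun s hs hds ⟨a', b', ha', hab'⟩ => ?_⟩
  have hsσ := hv.rigid_of_comp ha' hs hab' hx hσ hσζ (hpow hds)
  refine exists_comp_of_forall_dvd (S := {s | aeval σ s = aeval x s}) ?_ ?_ ?_ s hsσ
  · intro s hs
    rw [hrd]
    exact hv.dvd_natDegree hζ hd0 hx hσζ hs
  · rintro rfl; simp at hr0
  · intro s hs c j
    simp only [Set.mem_ofPred_eq] at hs ⊢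
    simp [hs, hrσ]

theorem exists_comp_of_dvd [IsAlgClosed F] [CharZero F] {a g b h : F[X]}
    (ha : 0 < a.natDegree) (hb : 0 < b.natDegree) (hg : 0 < g.natDegree) (hh : 0 < h.natDegree)
    (hab : a.comp g = b.comp h) (hdvd : g.natDegree ∣ h.natDegree) :
    ∃ u : F[X], h = u.comp g := by
  obtain ⟨r, hr, H⟩ := exists_common_right_factor hb hh hg hab.symm
  have hgcd : h.natDegree.gcd g.natDegree = g.natDegree := Nat.gcd_eq_right hdvd
  rw [hgcd] at hr H
  obtain ⟨w, hw⟩ := H h hh hdvd ⟨b, a, hb, hab.symm⟩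
  obtain ⟨w', hw'⟩ := H g hg dvd_rfl ⟨a, a, ha, rfl⟩
  have h1 := congrArg natDegree hw'
  rw [natDegree_comp, hr] at h1
  have h2 : w'.natDegree = 1 := by
    have : w'.natDegree * g.natDegree = 1 * g.natDegree := by rw [one_mul]; exact h1.symm
    exact Nat.eq_of_mul_eq_mul_right hg this
  obtain ⟨c, hc, e, rfl⟩ := natDegree_eq_one.1 h2
  have hr' : r = (C c⁻¹ * X - C (c⁻¹ * e)).comp g := by
    rw [hw']
    simp only [sub_comp, add_comp, mul_comp, C_comp, X_comp, mul_add, ← mul_assoc, ← C_mul,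
      inv_mul_cancel₀ hc, C_1, one_mul, add_sub_cancel_right]
  exact ⟨w.comp (C c⁻¹ * X - C (c⁻¹ * e)), by rw [comp_assoc, ← hr', ← hw]⟩

end Engstrom

section FibreProduct

variable {F : Type} [Field F]

theorem coeff_eq_zero_of_sum_comp_mul_pow {M : ℕ} {Q t : F[X]} (hQ : Q.natDegree = M)
    (hM : 0 < M) (ht : 0 < t.natDegree) (hcop : M.Coprime t.natDegree) (c : ℕ → F[X])
    (h : ∑ j ∈ Finset.range M, (c j).comp Q * t ^ j = 0) : ∀ j < M, c j = 0 := by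
  have ht0 : t ≠ 0 := by rintro rfl; simp at ht
  have hQ0 : 0 < Q.natDegree := hQ ▸ hM
  have hne : ∀ j, (c j).comp Q * t ^ j ≠ 0 → c j ≠ 0 := by
    rintro j hj h0
    simp [h0] at hj
  have hdeg : ∀ j, c j ≠ 0 → ((c j).comp Q * t ^ j) ≠ 0 ∧
      ((c j).comp Q * t ^ j).natDegree = (c j).natDegree * M + j * t.natDegree := by
    intro j hj
    have hc : (c j).comp Q ≠ 0 := by
      intro h0
      rcases comp_eq_zero_iff.1 h0 with h1 | ⟨_, h1⟩
      · exact hj h1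
      · rw [h1] at hQ0; simp at hQ0
    refine ⟨mul_ne_zero hc (pow_ne_zero _ ht0), ?_⟩
    rw [natDegree_mul hc (pow_ne_zero _ ht0), natDegree_comp, natDegree_pow, hQ]
  have hdis := degree_sum_eq_of_disjoint (fun j => (c j).comp Q * t ^ j) (Finset.range M) (by
    rintro i ⟨hi, hi0⟩ j ⟨hj, hj0⟩ hij
    rw [Finset.mem_range] at hi hj
    intro he
    simp only [Function.comp_apply] at he
    have h1 := natDegree_eq_of_degree_eq he
    rw [(hdeg i (hne i hi0)).2, (hdeg j (hne j hj0)).2] at h1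
    have h2 : i * t.natDegree ≡ j * t.natDegree [MOD M] := by
      have := congrArg (· % M) h1
      simpa [Nat.ModEq, Nat.add_mod, Nat.mul_mod_left] using this
    have h3 := Nat.ModEq.cancel_right_of_coprime hcop h2
    exact hij (Nat.ModEq.eq_of_lt_of_lt h3 hi hj))
  rw [h, degree_zero] at hdis
  intro j hj
  by_contra hcj
  have := Finset.le_sup (f := fun j => degree ((c j).comp Q * t ^ j)) (Finset.mem_range.2 hj)
  rw [← hdis, le_bot_iff, degree_eq_bot] at this
  exact (hdeg j hcj).1 this

/-- If `P ∘ t = t ∘ Q` with `deg P = deg Q` prime to `deg t`, the resulting square is surjective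
onto the fibre product. -/
theorem exists_eval_eq_of_coprime [IsAlgClosed F] {P Q t : F[X]} (h : P.comp t = t.comp Q)
    (hPQ : P.natDegree = Q.natDegree) (hP : 0 < P.natDegree) (ht : 0 < t.natDegree)
    (hcop : P.natDegree.Coprime t.natDegree) {p q : F} (hpq : t.eval p = P.eval q) :
    ∃ x : F, Q.eval x = p ∧ t.eval x = q := by
  let φ : F[X][X] →+* F[X] := eval₂RingHom (compRingHom Q) t
  have hP0 : P ≠ 0 := by rintro rfl; simp at hP
  have hQ0 : Q ≠ 0 := by rintro rfl; simp at hPQ; omega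
  set l := P.leadingCoeff⁻¹ with hl
  let D : F[X][X] := (P * C l).map C - C (t * C l)
  have hmonic : (P * C l).Monic := monic_mul_leadingCoeff_inv hP0
  have hPl : (P * C l).natDegree = P.natDegree :=
    natDegree_mul_C (inv_ne_zero (leadingCoeff_ne_zero.2 hP0))
  have hlt : (C (t * C l) : F[X][X]).degree < ((P * C l).map C).degree := by
    refine degree_C_le.trans_lt ?_
    rw [degree_eq_natDegree (hmonic.map C).ne_zero, hmonic.natDegree_map, hPl]
    exact_mod_cast hP
  have hD : D.Monic := (hmonic.map C).sub_of_left hlt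
  have hDdeg : D.natDegree = P.natDegree := by
    rw [← hPl, ← hmonic.natDegree_map (C : F →+* F[X])]
    exact natDegree_eq_of_degree_eq (degree_sub_eq_left_of_degree_lt hlt)
  have hφC : ∀ s : F[X], φ (C s) = s.comp Q := fun s => by simp [φ]
  have hφX : φ X = t := by simp [φ]
  have hφmap : ∀ s : F[X], φ (s.map C) = s.comp t := by
    intro s
    simp only [φ, coe_eval₂RingHom, eval₂_map]
    rw [show (compRingHom Q).comp (C : F →+* F[X]) = C by ext; simp, comp]
  have hφD : φ D = 0 := by
    simp only [D]
    rw [map_sub, hφmap, hφC, mul_comp, mul_comp, h, C_comp, C_comp, sub_self]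
  let e : F[X][X] →+* F := (evalRingHom p).comp (evalRingHom (C q))
  have heD : e D = 0 := by
    simp only [D, e, RingHom.comp_apply, coe_evalRingHom, eval_sub, eval_C]
    rw [eval_map, eval₂_at_apply, eval_C, eval_mul, eval_mul, hpq, eval_C, eval_C, sub_self]
  have hker : ∀ W : F[X][X], φ W = 0 → e W = 0 := by
    intro W hW
    have hdecomp := modByMonic_add_div W D
    set R := W %ₘ D with hR
    have hRdeg : R.natDegree < P.natDegree := by
      rw [← hDdeg]
      refine natDegree_modByMonic_lt W hD ?_
      intro h1
      rw [h1] at hDdeg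
      simp at hDdeg
      omega
    have hφR : φ R = 0 := by
      rw [← hdecomp, map_add, map_mul, hφD, zero_mul, add_zero] at hW
      exact hW
    have hsum : ∑ j ∈ Finset.range P.natDegree, (R.coeff j).comp Q * t ^ j = 0 := by
      rw [← hφR]
      simp only [φ, coe_eval₂RingHom]
      rw [eval₂_eq_sum_range' _ hRdeg]
      rfl
    have hc := coeff_eq_zero_of_sum_comp_mul_pow hPQ.symm hP ht hcop _ hsum
    have hR0 : R = 0 := by
      ext1 j
      by_cases hj : j < P.natDegree
      · simpa using hc j hj
      · rw [coeff_eq_zero_of_natDegree_lt (by omega), coeff_zero]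
    rw [← hdecomp, hR0, map_add, map_mul, heD, zero_mul, map_zero, add_zero]
  let _ : Algebra F[X][X] F[X] := φ.toAlgebra
  have hφalg : algebraMap F[X][X] F[X] = φ := rfl
  have hXint : IsIntegral F[X][X] (X : F[X]) := by
    set k := Q.leadingCoeff⁻¹ with hk
    have hQm : (Q * C k).Monic := monic_mul_leadingCoeff_inv hQ0
    have hQk : (Q * C k).natDegree = Q.natDegree :=
      natDegree_mul_C (inv_ne_zero (leadingCoeff_ne_zero.2 hQ0))
    refine ⟨(Q * C k).map (C.comp C) - C (C (X * C k)), ?_, ?_⟩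
    · refine (hQm.map _).sub_of_left (degree_C_le.trans_lt ?_)
      rw [degree_eq_natDegree (hQm.map _).ne_zero, hQm.natDegree_map, hQk, ← hPQ]
      exact_mod_cast hP
    · rw [eval₂_sub, eval₂_C, eval₂_map, hφalg, hφC,
        show φ.comp ((C : F[X] →+* F[X][X]).comp C) = C by ext; simp [hφC], eval₂_C_X, mul_comp,
        X_comp, C_comp, sub_self]
  have hint : Algebra.IsIntegral F[X][X] F[X] := by
    refine ⟨fun s => ?_⟩
    induction s using Polynomial.induction_on' with
    | add p q hp hq => exact hp.add hq
    | monomial n a =>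
      rw [← C_mul_X_pow_eq_monomial]
      refine IsIntegral.mul ?_ (hXint.pow n)
      have : (C a : F[X]) = algebraMap F[X][X] F[X] (C (C a)) := by rw [hφalg, hφC, C_comp]
      rw [this]
      exact isIntegral_algebraMap
  have hprime : (RingHom.ker e).IsPrime := RingHom.ker_isPrime e
  obtain ⟨𝔮, -, h𝔮, hcomap⟩ := Ideal.exists_ideal_over_prime_of_isIntegral (RingHom.ker e)
    (⊥ : Ideal F[X]) (fun W hW => hker W (by simpa [Ideal.mem_comap, hφalg] using hW))
  have hmem : ∀ W, e W = 0 → φ W ∈ 𝔮 := by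
    intro W hW
    have : W ∈ 𝔮.comap (algebraMap F[X][X] F[X]) := by rw [hcomap]; exact hW
    exact this
  have h1 : Q - C p ∈ 𝔮 := by
    have := hmem (C (X - C p)) (by simp [e])
    rwa [hφC, sub_comp, X_comp, C_comp] at this
  have h2 : t - C q ∈ 𝔮 := by
    have := hmem (X - C (C q)) (by simp [e])
    rwa [map_sub, hφX, hφC, C_comp] at this
  by_contra hcon
  have hcopr : IsCoprime (Q - C p) (t - C q) := by
    rw [isCoprime_iff_aeval_ne_zero_of_isAlgClosed F F]
    intro a
    by_contra! hh
    refine hcon ⟨a, ?_, ?_⟩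
    · simpa [sub_eq_zero] using hh.1
    · simpa [sub_eq_zero] using hh.2
  obtain ⟨a, b, hab⟩ := hcopr
  exact h𝔮.ne_top ((Ideal.eq_top_iff_one _).2
    (hab ▸ 𝔮.add_mem (𝔮.mul_mem_left _ h1) (𝔮.mul_mem_left _ h2)))

end FibreProduct

section Ramification

variable {F : Type} [Field F]

open Classical in
/-- The points over `y` whose multiplicity is not divisible by `a`. -/
noncomputable def badFib (P : F[X]) (a : ℕ) (y : F) : Finset F :=
  (fib P y).filter fun q => ¬ a ∣ mu P q

/-- All but boundedly many points in the fibres of the iterates of `g` over `y` have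
multiplicity divisible by `a`. -/
def EvRamified (g : F[X]) (a : ℕ) (y : F) : Prop :=
  ∃ B : ℕ, ∀ k, (badFib (polIter g k) a y).card ≤ B

theorem card_fib_le [IsAlgClosed F] {P : F[X]} (hP : 0 < P.natDegree) (a : ℕ) (y : F) :
    ∃ G, a * G ≤ P.natDegree ∧ (fib P y).card = G + (badFib P a y).card := by
  classical
  refine ⟨((fib P y).filter fun q => a ∣ mu P q).card, ?_, ?_⟩
  · rw [← sum_mu hP y, mul_comm, ← smul_eq_mul]
    refine (Finset.card_nsmul_le_sum _ (mu P) a fun q hq => ?_).trans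
      (Finset.sum_le_sum_of_subset (Finset.filter_subset _ _))
    exact Nat.le_of_dvd (mu_pos hP q) (Finset.mem_filter.1 hq).2
  · rw [badFib]
    exact (Finset.card_filter_add_card_filter_not _).symm

theorem exists_natDegree_polIter_gt {g : F[X]} (hg : 2 ≤ g.natDegree) (B : ℕ) :
    ∃ k, B < (polIter g k).natDegree := by
  refine ⟨B, ?_⟩
  rw [natDegree_polIter]
  exact Nat.lt_pow_self (by omega)

theorem EvRamified.preimage {g : F[X]} (hg : 2 ≤ g.natDegree) {a : ℕ} {q : F} (ha : 0 < a)
    (hy : EvRamified g a (g.eval q)) : EvRamified g (a / a.gcd (mu g q)) q := by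
  classical
  obtain ⟨B, hB⟩ := hy
  refine ⟨B, fun k => le_trans (Finset.card_le_card ?_) (hB (k + 1))⟩
  have hk := natDegree_polIter_pos (f := g) (by omega) k
  have hk' := natDegree_polIter_pos (f := g) (by omega) (k + 1)
  intro w hw
  rw [badFib, Finset.mem_filter, mem_fib hk] at hw
  obtain ⟨hwq, hw⟩ := hw
  rw [badFib, Finset.mem_filter, mem_fib hk', polIter, eval_comp, hwq,
    mu_comp (by omega) hk, hwq]
  refine ⟨rfl, fun hdvd => hw ?_⟩
  have hd : 0 < a.gcd (mu g q) := Nat.gcd_pos_of_pos_left _ ha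
  refine (Nat.coprime_div_gcd_div_gcd hd).dvd_of_dvd_mul_left ?_
  have h1 := Nat.div_dvd_div (Nat.gcd_dvd_left a (mu g q)) hdvd
  rwa [Nat.mul_div_right_comm (Nat.gcd_dvd_right _ _)] at h1

theorem comp_polIter_of_semiconj {g t g' : F[X]} (h : g.comp t = t.comp g') (k : ℕ) :
    (polIter g k).comp t = t.comp (polIter g' k) := by
  induction k with
  | zero => simp [polIter]
  | succ k ih => rw [polIter, comp_assoc, ih, ← comp_assoc, h, comp_assoc, polIter]

variable [IsAlgClosed F] [CharZero F]

theorem EvRamified.eq_two {g : F[X]} (hg : 2 ≤ g.natDegree) {a b : ℕ} {y z : F}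
    (ha : 2 ≤ a) (hb : 2 ≤ b) (hy : EvRamified g a y) (hz : EvRamified g b z) (hne : y ≠ z) :
    a = 2 := by
  classical
  obtain ⟨B, hB⟩ := hy
  obtain ⟨B', hB'⟩ := hz
  obtain ⟨k, hk⟩ := exists_natDegree_polIter_gt hg (6 * (B + B'))
  have hpos := natDegree_polIter_pos (f := g) (by omega) k
  by_contra h2
  have ha3 : 3 ≤ a := by omega
  obtain ⟨G, hG, hG'⟩ := card_fib_le hpos a y
  obtain ⟨G', hGz, hGz'⟩ := card_fib_le hpos b z
  have h := card_fib_sum hpos {y, z}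
  rw [Finset.card_pair hne, Finset.sum_pair hne] at h
  have := hB k
  have := hB' k
  have := Nat.mul_le_mul_right G ha3
  have := Nat.mul_le_mul_right G' hb
  omega

theorem EvRamified.not_three {g : F[X]} (hg : 2 ≤ g.natDegree) {x y z : F}
    (hx : EvRamified g 2 x) (hy : EvRamified g 2 y) (hz : EvRamified g 2 z)
    (hxy : x ≠ y) (hxz : x ≠ z) (hyz : y ≠ z) : False := by
  classical
  obtain ⟨B, hB⟩ := hx
  obtain ⟨B', hB'⟩ := hy
  obtain ⟨B'', hB''⟩ := hz
  obtain ⟨k, hk⟩ := exists_natDegree_polIter_gt hg (2 * (B + B' + B''))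
  have hpos := natDegree_polIter_pos (f := g) (by omega) k
  obtain ⟨G, hG, hG'⟩ := card_fib_le hpos 2 x
  obtain ⟨H, hH, hH'⟩ := card_fib_le hpos 2 y
  obtain ⟨J, hJ, hJ'⟩ := card_fib_le hpos 2 z
  have h := card_fib_sum hpos {x, y, z}
  rw [Finset.card_eq_three.2 ⟨x, y, z, hxy, hxz, hyz, rfl⟩,
    Finset.sum_insert (by simp [hxy, hxz]), Finset.sum_pair hyz] at h
  have := hB k
  have := hB' k
  have := hB'' k
  omega

theorem two_le_div_gcd {a e : ℕ} (ha : 0 < a) (h : ¬ a ∣ e) : 2 ≤ a / a.gcd e := by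
  obtain ⟨c, hc⟩ := Nat.gcd_dvd_left a e
  have hd : 0 < a.gcd e := Nat.gcd_pos_of_pos_left _ ha
  have : a / a.gcd e = c := Nat.div_eq_of_eq_mul_right hd hc
  rw [this]
  by_contra hlt
  have : c = 0 ∨ c = 1 := by omega
  rcases this with rfl | rfl
  · omega
  · rw [mul_one] at hc
    exact h (hc ▸ Nat.gcd_dvd_right a e)

theorem evRamified_of_semiconj {g t g' : F[X]} (hg : 2 ≤ g.natDegree) (ht : 0 < t.natDegree)
    (h : g.comp t = t.comp g') (hcop : g.natDegree.Coprime t.natDegree) (p : F) :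
    EvRamified g (mu t p) (t.eval p) := by
  classical
  refine ⟨((derivative t).roots.toFinset.image fun x => t.eval x).card, fun k =>
    Finset.card_le_card fun q hq => ?_⟩
  have hgg' : g.natDegree = g'.natDegree := by
    have := congrArg natDegree h
    rw [natDegree_comp, natDegree_comp, mul_comm] at this
    exact Nat.eq_of_mul_eq_mul_left ht this
  have hk := natDegree_polIter_pos (f := g) (by omega) k
  have hk' := natDegree_polIter_pos (f := g') (by omega) k
  rw [badFib, Finset.mem_filter, mem_fib hk] at hq
  obtain ⟨hq, hbad⟩ := hq
  have hsemi := comp_polIter_of_semiconj h k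
  obtain ⟨x, hx, rfl⟩ := exists_eval_eq_of_coprime hsemi
    (by rw [natDegree_polIter, natDegree_polIter, hgg']) hk ht
    (by rw [natDegree_polIter]; exact hcop.pow_left k) hq.symm
  refine Finset.mem_image.2 ⟨x, ?_, rfl⟩
  have hmu : mu ((polIter g k).comp t) x = mu (t.comp (polIter g' k)) x := by rw [hsemi]
  rw [mu_comp hk ht, mu_comp ht hk', hx] at hmu
  have hd : derivative t ≠ 0 := fun h => ht.ne' (derivative_eq_zero.1 h)
  rw [Multiset.mem_toFinset, ← Multiset.count_pos, count_roots, mu_derivative]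
  by_contra hcon
  have h1 : mu t x = 1 := by have := mu_pos ht x; omega
  rw [h1, mul_one] at hmu
  exact hbad ⟨_, hmu⟩

end Ramification

section SpecialType

variable {F : Type} [Field F]

open Classical in
/-- The points of odd multiplicity over `T`. -/
noncomputable def oddFib (P : F[X]) (T : Finset F) : Finset F :=
  (T.biUnion (fib P)).filter fun q => Odd (mu P q)

theorem mem_oddFib {P : F[X]} (hP : 0 < P.natDegree) {T : Finset F} {q : F} :
    q ∈ oddFib P T ↔ P.eval q ∈ T ∧ Odd (mu P q) := by
  classical
  simp [oddFib, mem_fib hP]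

/-- Either `g` has a totally invariant point (as for `X ^ d`), or it permutes a pair of points
with the ramification behaviour of a Chebyshev polynomial. -/
def SpecialType (g : F[X]) : Prop :=
  (∃ y, fib g y = {y}) ∨ ∃ T : Finset F, T.card = 2 ∧ oddFib g T = T

theorem fib_nonempty [IsAlgClosed F] {P : F[X]} (hP : 0 < P.natDegree) (y : F) : (fib P y).Nonempty := by
  rw [Finset.nonempty_iff_ne_empty]
  intro h
  have := sum_mu hP y
  rw [h, Finset.sum_empty] at this
  omega

variable [IsAlgClosed F] [CharZero F]

theorem card_oddFib {P : F[X]} (hP : 0 < P.natDegree) (T : Finset F) :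
    T.card * P.natDegree ≤ (oddFib P T).card + 2 * (P.natDegree - 1) := by
  classical
  have hdisj : (T : Set F).PairwiseDisjoint (fib P) := by
    intro a _ b _ hab
    rw [Function.onFun, Finset.disjoint_left]
    intro q hq hq'
    rw [mem_fib hP] at hq hq'
    exact hab (hq.symm.trans hq')
  have h1 : T.card * P.natDegree = ∑ q ∈ T.biUnion (fib P), mu P q := by
    rw [Finset.sum_biUnion hdisj, Finset.sum_congr rfl fun y _ => sum_mu hP y]
    simp
  rw [h1, oddFib, Finset.card_filter]
  refine le_trans ?_ (Nat.add_le_add_left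
    (Nat.mul_le_mul_left 2 (sum_mu_sub_one_le hP (T.biUnion (fib P)))) _)
  rw [Finset.mul_sum, ← Finset.sum_add_distrib]
  refine Finset.sum_le_sum fun q _ => ?_
  have := mu_pos hP q
  split_ifs with h
  · omega
  · rw [Nat.not_odd_iff_even] at h
    obtain ⟨c, hc⟩ := h
    omega

theorem SpecialType.of_commute {f g : F[X]} (hf : 0 < f.natDegree) (hg : 2 ≤ g.natDegree)
    (h : PolyCommute f g) (hs : SpecialType g) : SpecialType f := by
  classical
  have hg0 : 0 < g.natDegree := by omega
  have hev : ∀ q, f.eval (g.eval q) = g.eval (f.eval q) := fun q => by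
    rw [← eval_comp, ← eval_comp, show f.comp g = g.comp f from h]
  rcases hs with ⟨y, hy⟩ | ⟨T, hT, hT'⟩
  · left
    refine ⟨y, ?_⟩
    have hinv : ∀ q, g.eval q = y ↔ q = y := fun q => by
      rw [← mem_fib hg0, hy, Finset.mem_singleton]
    have hsub : (fib f y ∪ {y}).biUnion (fib g) ⊆ fib f y ∪ {y} := by
      intro q hq
      obtain ⟨z, hz, hq⟩ := Finset.mem_biUnion.1 hq
      rw [mem_fib hg0] at hq
      subst hq
      rw [Finset.mem_union, mem_fib hf, Finset.mem_singleton] at hz ⊢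
      rcases hz with hz | hz
      · left; rwa [hev, hinv] at hz
      · right; exact (hinv q).1 hz
    have hdisj : ((fib f y ∪ {y} : Finset F) : Set F).PairwiseDisjoint (fib g) := by
      intro a _ b _ hab
      rw [Function.onFun, Finset.disjoint_left]
      intro q hq hq'
      rw [mem_fib hg0] at hq hq'
      exact hab (hq.symm.trans hq')
    have h1 := card_fib_sum hg0 (fib f y ∪ {y})
    rw [← Finset.card_biUnion hdisj] at h1
    have h2 := Finset.card_le_card hsub
    have h3 : (fib f y ∪ {y}).card ≤ 1 := by
      by_contra hlt
      obtain ⟨m, hm⟩ : ∃ m, g.natDegree = m + 2 := ⟨g.natDegree - 2, by omega⟩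
      obtain ⟨c, hc⟩ : ∃ c, (fib f y ∪ {y}).card = c + 2 :=
        ⟨(fib f y ∪ {y}).card - 2, by omega⟩
      rw [hm, hc] at h1
      rw [hc] at h2
      have h4 : (c + 2) * (m + 2) = c * m + 2 * c + 2 * m + 4 := by ring
      have h5 := Nat.zero_le (c * m)
      omega
    rw [Finset.card_le_one] at h3
    refine Finset.eq_singleton_iff_nonempty_unique_mem.2 ⟨fib_nonempty hf y, fun q hq => ?_⟩
    exact h3 q (Finset.mem_union_left _ hq) y (by simp)
  · right
    refine ⟨T, hT, ?_⟩
    have hTodd : ∀ q, g.eval q ∈ T ∧ Odd (mu g q) ↔ q ∈ T := fun q => by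
      rw [← mem_oddFib hg0, hT']
    have hsub : oddFib g (T ∪ oddFib f T) ⊆ T ∪ oddFib f T := by
      intro q hq
      rw [mem_oddFib hg0, Finset.mem_union, mem_oddFib hf] at hq
      rw [Finset.mem_union, mem_oddFib hf]
      obtain ⟨h1 | ⟨h1, h2⟩, h3⟩ := hq
      · exact Or.inl ((hTodd q).1 ⟨h1, h3⟩)
      · right
        have hmu : mu (f.comp g) q = mu (g.comp f) q := by rw [show f.comp g = g.comp f from h]
        rw [mu_comp hf hg0, mu_comp hg0 hf] at hmu
        have h4 := h2.mul h3
        rw [hmu, Nat.odd_mul] at h4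
        rw [hev] at h1
        exact ⟨(hTodd _).1 ⟨h1, h4.1⟩, h4.2⟩
    have h1 := card_oddFib hg0 (T ∪ oddFib f T)
    have h2 := Finset.card_le_card hsub
    have h3 : (T ∪ oddFib f T).card ≤ 2 := by
      by_contra hlt
      obtain ⟨m, hm⟩ : ∃ m, g.natDegree = m + 2 := ⟨g.natDegree - 2, by omega⟩
      obtain ⟨c, hc⟩ : ∃ c, (T ∪ oddFib f T).card = c + 3 :=
        ⟨(T ∪ oddFib f T).card - 3, by omega⟩
      rw [hm, hc] at h1
      rw [hc] at h2
      have h4 : (c + 3) * (m + 2) = c * m + 2 * c + 3 * m + 6 := by ring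
      have h5 := Nat.zero_le (c * m)
      omega
    have h4 : T ∪ oddFib f T = T :=
      (Finset.eq_of_subset_of_card_le Finset.subset_union_left (by omega)).symm
    refine Finset.eq_of_subset_of_card_le (Finset.union_eq_left.1 h4) ?_
    have h5 := card_oddFib hf T
    rw [hT] at h5 ⊢
    omega

theorem card_fib_eq_one_of_critical {P : F[X]} (hP : 0 < P.natDegree) {y : F}
    (h : ∀ q, 2 ≤ mu P q → P.eval q = y) : (fib P y).card = 1 := by
  classical
  have h1 : P.natDegree - 1 ≤ ∑ q ∈ fib P y, (mu P q - 1) := by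
    rw [← natDegree_derivative P,
      (IsAlgClosed.splits (derivative P)).natDegree_eq_card_roots,
      ← Multiset.sum_count_eq_card (s := fib P y)]
    · refine Finset.sum_le_sum fun q _ => ?_
      rw [count_roots, mu_derivative]
    · intro q hq
      rw [mem_fib hP]
      rw [← Multiset.count_pos, count_roots, mu_derivative] at hq
      exact h q (by omega)
  have h2 : P.natDegree = ∑ q ∈ fib P y, (mu P q - 1) + (fib P y).card := by
    rw [← sum_mu hP y, Finset.card_eq_sum_ones, ← Finset.sum_add_distrib]
    refine Finset.sum_congr rfl fun q _ => ?_
    have := mu_pos hP q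
    omega
  have := (fib_nonempty hP y).card_pos
  omega

theorem exists_eq_mul_dvd_pow_coprime (m N : ℕ) (hN : 0 < N) :
    ∃ a b K, N = a * b ∧ a ∣ m ^ K ∧ b.Coprime m := by
  induction N using Nat.strong_induction_on with
  | _ N ih =>
    by_cases h : N.Coprime m
    · exact ⟨1, N, 0, by simp, by simp, h⟩
    · obtain ⟨N', hN'⟩ := Nat.gcd_dvd_left N m
      have h2 : 0 < N.gcd m := Nat.gcd_pos_of_pos_left _ hN
      have h1 : 1 < N.gcd m := by
        have : N.gcd m ≠ 1 := h
        omega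
      have hN'0 : 0 < N' := by
        rcases Nat.eq_zero_or_pos N' with rfl | h0
        · simp at hN'; omega
        · exact h0
      obtain ⟨a, b, K, h3, h4, h5⟩ := ih N' (by nlinarith) hN'0
      refine ⟨N.gcd m * a, b, K + 1, ?_, ?_, h5⟩
      · rw [mul_assoc, ← h3]; exact hN'
      · rw [pow_succ']; exact mul_dvd_mul (Nat.gcd_dvd_right _ _) h4

theorem specialType_of_semiconj {g t g' : F[X]} (hg : 2 ≤ g.natDegree) (ht : 3 ≤ t.natDegree)
    (hlt : g.natDegree < t.natDegree) (h : g.comp t = t.comp g')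
    (hcop : g.natDegree.Coprime t.natDegree) : SpecialType g := by
  classical
  have hg0 : 0 < g.natDegree := by omega
  have ht0 : 0 < t.natDegree := by omega
  have hram := evRamified_of_semiconj hg ht0 h hcop
  by_cases hcrit : ∃ p q, 2 ≤ mu t p ∧ 2 ≤ mu t q ∧ t.eval p ≠ t.eval q
  · obtain ⟨p, q, hp, hq, hne⟩ := hcrit
    right
    refine ⟨{t.eval p, t.eval q}, Finset.card_pair hne, ?_⟩
    have h1 := hram p
    have h2 := hram q
    rw [h1.eq_two hg hp hq h2 hne] at h1
    rw [h2.eq_two hg hq le_rfl h1 hne.symm] at h2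
    have hsub : oddFib g {t.eval p, t.eval q} ⊆ {t.eval p, t.eval q} := by
      intro w hw
      rw [mem_oddFib hg0, Finset.mem_insert, Finset.mem_singleton] at hw
      obtain ⟨hw, hodd⟩ := hw
      have hw2 : EvRamified g 2 (g.eval w) := by rcases hw with hw | hw <;> rwa [hw]
      have h3 := hw2.preimage hg two_pos
      have h4 : Nat.gcd 2 (mu g w) = 1 := Nat.coprime_two_left.2 hodd
      rw [h4, Nat.div_one] at h3
      by_contra hcon
      rw [Finset.mem_insert, Finset.mem_singleton, not_or] at hcon
      exact h1.not_three hg h2 h3 hne (Ne.symm hcon.1) (Ne.symm hcon.2)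
    refine Finset.eq_of_subset_of_card_le hsub ?_
    have h5 := card_oddFib hg0 {t.eval p, t.eval q}
    rw [Finset.card_pair hne] at h5 ⊢
    omega
  · push Not at hcrit
    left
    obtain ⟨y, hy⟩ : ∃ y, ∀ q, 2 ≤ mu t q → t.eval q = y := by
      by_cases hex : ∃ p, 2 ≤ mu t p
      · obtain ⟨p, hp⟩ := hex
        exact ⟨t.eval p, fun q hq => hcrit q p hq hp⟩
      · push Not at hex
        exact ⟨0, fun q hq => absurd hq (by have := hex q; omega)⟩
    obtain ⟨z, hz⟩ := Finset.card_eq_one.1 (card_fib_eq_one_of_critical ht0 hy)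
    have hzy : t.eval z = y := by rw [← mem_fib ht0, hz]; simp
    have hmu : mu t z = t.natDegree := by
      rw [← sum_mu ht0 y, hz, Finset.sum_singleton]
    have hyram := hram z
    rw [hmu, hzy] at hyram
    refine ⟨y, Finset.eq_singleton_iff_nonempty_unique_mem.2 ⟨fib_nonempty hg0 y, ?_⟩⟩
    intro q hq
    rw [mem_fib hg0] at hq
    subst hq
    by_contra hne
    have h1 := hyram.preimage hg ht0
    have h2 : ¬ t.natDegree ∣ mu g q := fun hd => by
      have := Nat.le_of_dvd (mu_pos hg0 q) hd
      have := mu_le g q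
      omega
    have := hyram.eq_two hg (by omega) (two_le_div_gcd ht0 h2) h1 (Ne.symm hne)
    omega

/-- If `f` and `g` commute and some prime divides `deg f` but not `deg g ≥ 2`, then `g` is of
special type. -/
theorem specialType_of_prime {f g : F[X]} (h : PolyCommute f g) (hg : 2 ≤ g.natDegree)
    (hf : 0 < f.natDegree) {p : ℕ} (hp : p.Prime) (hpf : p ∣ f.natDegree)
    (hpg : ¬ p ∣ g.natDegree) : SpecialType g := by
  set m := g.natDegree with hm
  obtain ⟨a, b, K, hab, haK, hbm⟩ := exists_eq_mul_dvd_pow_coprime m _ hf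
  have hpb : p ∣ b := by
    rw [hab] at hpf
    refine (hp.dvd_mul.1 hpf).resolve_left fun hpa => hpg ?_
    exact hp.dvd_of_dvd_pow (hpa.trans haK)
  have hb0 : 0 < b := Nat.pos_of_ne_zero (by rintro rfl; omega)
  have ha0 : 0 < a := Nat.pos_of_ne_zero (by rintro rfl; omega)
  have hb2 : 2 ≤ b := hp.two_le.trans (Nat.le_of_dvd hb0 hpb)
  have hbpow : m < b ^ m := Nat.lt_pow_self (by omega)
  have hbpow3 : 3 ≤ b ^ m := by
    calc 3 ≤ 2 ^ 2 := by norm_num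
      _ ≤ b ^ 2 := Nat.pow_le_pow_left hb2 2
      _ ≤ b ^ m := Nat.pow_le_pow_right hb0 hg
  set H := polIter f m with hH
  set G := polIter g (K * m) with hG
  have hHdeg : H.natDegree = a ^ m * b ^ m := by rw [hH, natDegree_polIter, hab, mul_pow]
  have hGdeg : G.natDegree = m ^ (K * m) := natDegree_polIter _ _
  have hH0 : 0 < H.natDegree := natDegree_polIter_pos hf _
  have hG0 : 0 < G.natDegree := natDegree_polIter_pos (by omega) _
  have hHg : PolyCommute H g := h.iter_left m
  have hHG : H.comp G = G.comp H := hHg.iter_right _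
  obtain ⟨r, hr, hfac⟩ := exists_common_right_factor hH0 hG0 hH0 hHG
  have hgcd : G.natDegree.gcd H.natDegree = a ^ m := by
    rw [hGdeg, hHdeg, pow_mul, Nat.Coprime.gcd_mul_right_cancel_right _ ?_]
    · exact Nat.gcd_eq_right (pow_dvd_pow_of_dvd haK m)
    · exact Nat.Coprime.pow _ _ (hbm.pow_right K)
  rw [hgcd] at hr hfac
  obtain ⟨t, ht⟩ := hfac H hH0 (hHdeg ▸ dvd_mul_right _ _) ⟨H, H, hH0, rfl⟩
  have htdeg : t.natDegree = b ^ m := by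
    have h1 := hHdeg
    rw [ht, natDegree_comp, hr, mul_comm] at h1
    exact Nat.eq_of_mul_eq_mul_left (pow_pos ha0 m) h1
  have hr0 : 0 < r.natDegree := by rw [hr]; positivity
  have hg0 : 0 < g.natDegree := by omega
  obtain ⟨g', hg'⟩ := hfac (r.comp g) (natDegree_comp_pos hr0 hg0)
    (by rw [natDegree_comp, hr]; exact dvd_mul_right _ _)
    ⟨t, g, by omega, by rw [← comp_assoc, ← ht]; exact hHg⟩
  have hsemi : g.comp t = t.comp g' := by
    refine comp_right_cancel hr0 ?_
    rw [comp_assoc, ← ht, comp_assoc, ← hg', ← comp_assoc, ← ht]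
    exact hHg.symm
  refine specialType_of_semiconj hg (by omega) (by omega) hsemi ?_
  rw [htdeg]
  exact (hbm.pow_left m).symm

end SpecialType

section Special

variable {F : Type} [Field F]

/-- The polynomial whose value at `x ≠ 0` is `x ^ N * P (x + x⁻¹)`, when `P` has degree at
most `N`. -/
noncomputable def joukowski (N : ℕ) (P : F[X]) : F[X] :=
  ∑ i ∈ Finset.range (N + 1), C (P.coeff i) * ((X ^ 2 + 1) ^ i * X ^ (N - i))

theorem eval_joukowski {N : ℕ} {P : F[X]} (hP : P.natDegree ≤ N) {x : F} (hx : x ≠ 0) :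
    (joukowski N P).eval x = x ^ N * P.eval (x + x⁻¹) := by
  rw [joukowski, eval_finsetSum, eval_eq_sum_range' (n := N + 1) (by omega), Finset.mul_sum]
  refine Finset.sum_congr rfl fun i hi => ?_
  rw [Finset.mem_range] at hi
  obtain ⟨k, rfl⟩ : ∃ k, N = i + k := ⟨N - i, by omega⟩
  have h1 : x ^ 2 + 1 = x * (x + x⁻¹) := by field_simp
  simp only [eval_mul, eval_C, eval_pow, eval_add, eval_X, eval_one, Nat.add_sub_cancel_left]
  rw [h1, mul_pow]
  ring

theorem coeff_zero_joukowski (N : ℕ) (P : F[X]) : (joukowski N P).coeff 0 = P.coeff N := by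
  rw [coeff_zero_eq_eval_zero, joukowski, eval_finsetSum, Finset.sum_eq_single N]
  · simp
  · intro i hi hne
    rw [Finset.mem_range] at hi
    have : N - i ≠ 0 := by omega
    simp [this]
  · simp

theorem eq_of_eval_eq_of_ne_zero [CharZero F] {P Q : F[X]}
    (h : ∀ x : F, x ≠ 0 → P.eval x = Q.eval x) : P = Q := by
  refine mul_left_cancel₀ (X_ne_zero (R := F)) (Polynomial.funext fun x => ?_)
  by_cases hx : x = 0
  · simp [hx]
  · simp [h x hx]

theorem isChebyshevPoly_of_pell [CharZero F] {G w : F[X]} (hG : 0 < G.natDegree)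
    (h : G ^ 2 - 4 = (X ^ 2 - 4) * w ^ 2) :
    IsChebyshevPoly G.natDegree G ∨ IsChebyshevPoly G.natDegree (-G) := by
  set D := G.natDegree with hD
  have h4 : (4 : F[X]) = C 4 := (map_ofNat C 4).symm
  have hX : (X ^ 2 - 4 : F[X]).natDegree = 2 := by
    rw [h4]; exact natDegree_X_pow_sub_C
  have hw : w.natDegree ≤ D - 1 := by
    have h1 := congrArg natDegree h
    rw [h4, natDegree_sub_C, natDegree_pow, ← h4] at h1
    have hw0 : w ≠ 0 := by
      rintro rfl
      simp at h1
      omega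
    have hX0 : (X ^ 2 - 4 : F[X]) ≠ 0 := by
      intro h0; rw [h0] at hX; simp at hX
    rw [natDegree_mul hX0 (pow_ne_zero 2 hw0), natDegree_pow, hX] at h1
    omega
  set P := joukowski D G with hP
  set Q := (X ^ 2 - 1) * joukowski (D - 1) w with hQ
  have hPe : ∀ x : F, x ≠ 0 → P.eval x = x ^ D * G.eval (x + x⁻¹) :=
    fun x hx => eval_joukowski le_rfl hx
  have hQe : ∀ x : F, x ≠ 0 → Q.eval x = x ^ D * ((x - x⁻¹) * w.eval (x + x⁻¹)) := by
    intro x hx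
    obtain ⟨k, hk⟩ : ∃ k, D = k + 1 := ⟨D - 1, by omega⟩
    rw [hQ, eval_mul, eval_joukowski hw hx, hk, Nat.add_sub_cancel]
    simp only [eval_sub, eval_pow, eval_X, eval_one]
    have : x ^ 2 - 1 = x * (x - x⁻¹) := by field_simp
    rw [this]; ring
  set A := C (2⁻¹ : F) * (P + Q) with hA
  set B := C (2⁻¹ : F) * (P - Q) with hB
  have hAB : A * B = X ^ (2 * D) := by
    refine eq_of_eval_eq_of_ne_zero fun x hx => ?_
    have h1 := congrArg (eval (x + x⁻¹)) h
    simp only [eval_sub, eval_pow, eval_mul, eval_X, h4, eval_C] at h1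
    have h2 : (x + x⁻¹) ^ 2 - 4 = (x - x⁻¹) ^ 2 := by field_simp; ring
    rw [h2] at h1
    simp only [hA, hB, eval_mul, eval_C, eval_add, eval_sub, eval_pow, eval_X, hPe x hx, hQe x hx]
    have h3 : x ^ (2 * D) = (x ^ D) ^ 2 := by ring
    rw [h3]
    linear_combination (x ^ D) ^ 2 / 4 * h1
  have hsum : A + B = P := by
    rw [hA, hB, ← mul_add, show P + Q + (P - Q) = C 2 * P by rw [map_ofNat]; ring, ← mul_assoc, ← C_mul]
    simp
  obtain ⟨k, hk, hass⟩ := (dvd_prime_pow prime_X (2 * D)).1 (Dvd.intro B hAB)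
  obtain ⟨u, hu⟩ := hass.symm
  obtain ⟨l, hl, hlu⟩ := Polynomial.isUnit_iff.1 u.isUnit
  have hl0 : l ≠ 0 := hl.ne_zero
  have hAeq : A = C l * X ^ k := by rw [← hu, ← hlu, mul_comm]
  have hBeq : B = C l⁻¹ * X ^ (2 * D - k) := by
    have hA0 : A ≠ 0 := by
      rw [hAeq]; exact mul_ne_zero (C_ne_zero.2 hl0) (pow_ne_zero _ X_ne_zero)
    refine mul_left_cancel₀ hA0 ?_
    rw [hAB, hAeq, mul_mul_mul_comm, ← C_mul, mul_inv_cancel₀ hl0, C_1, one_mul, ← pow_add,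
      Nat.add_sub_cancel' hk]
  have hk0 : k = 0 ∨ k = 2 * D := by
    by_contra hne
    have h1 : P.coeff 0 = G.coeff D := coeff_zero_joukowski D G
    rw [← hsum, hAeq, hBeq, coeff_zero_eq_eval_zero] at h1
    have h5 : 2 * D - k ≠ 0 := by omega
    have h6 : k ≠ 0 := by omega
    simp only [eval_add, eval_mul, eval_C, eval_pow, eval_X, ne_eq, h5, h6, not_false_eq_true,
      zero_pow, mul_zero, add_zero] at h1
    have : G = 0 := leadingCoeff_eq_zero.1 h1.symm
    rw [hD, this] at hG
    simp at hG
  obtain ⟨m, hm0, hm⟩ : ∃ m : F, m ≠ 0 ∧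
      ∀ x : F, x ≠ 0 → G.eval (x + x⁻¹) = m * x ^ D + m⁻¹ * (x⁻¹) ^ D := by
    rcases hk0 with rfl | rfl
    · refine ⟨l⁻¹, inv_ne_zero hl0, fun x hx => ?_⟩
      have h1 := hPe x hx
      rw [← hsum, hAeq, hBeq] at h1
      simp only [eval_add, eval_mul, eval_C, eval_pow, eval_X, Nat.sub_zero] at h1
      refine mul_left_cancel₀ (pow_ne_zero D hx) ?_
      have h2 : x ^ D * x⁻¹ ^ D = 1 := by rw [← mul_pow, mul_inv_cancel₀ hx, one_pow]
      rw [← h1]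
      rw [inv_inv]
      linear_combination -l * h2
    · refine ⟨l, hl0, fun x hx => ?_⟩
      have h1 := hPe x hx
      rw [← hsum, hAeq, hBeq] at h1
      simp only [eval_add, eval_mul, eval_C, eval_pow, eval_X, Nat.sub_self] at h1
      refine mul_left_cancel₀ (pow_ne_zero D hx) ?_
      have h2 : x ^ D * x⁻¹ ^ D = 1 := by rw [← mul_pow, mul_inv_cancel₀ hx, one_pow]
      rw [← h1]
      linear_combination -l⁻¹ * h2
  have h7 := hm 1 one_ne_zero
  have h8 := congrArg (eval (1 + 1⁻¹)) h
  simp only [eval_sub, eval_pow, eval_mul, eval_X, h4, eval_C, h7] at h8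
  have h9 : (m - 1) * (m + 1) = 0 := by
    have h10 : (m - m⁻¹) ^ 2 = 0 := by
      have h11 : m * m⁻¹ = 1 := mul_inv_cancel₀ hm0
      simp only [inv_one, one_pow, mul_one] at h8
      linear_combination h8 - 4 * h11
    have h11 : m - m⁻¹ = 0 := by simpa using h10
    have h12 : m * m⁻¹ = 1 := mul_inv_cancel₀ hm0
    linear_combination m * h11 + h12
  rcases mul_eq_zero.1 h9 with h | h
  · left
    intro x hx
    rw [hm x hx, sub_eq_zero.1 h]
    simp
  · right
    intro x hx
    rw [eval_neg, hm x hx, eq_neg_of_add_eq_zero_left h, inv_neg]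
    simp
    ring

variable [IsAlgClosed F]

theorem exists_sq_of_even_rootMultiplicity {P : F[X]}
    (h : ∀ q, Even (P.rootMultiplicity q)) : ∃ w, P = w ^ 2 := by
  classical
  obtain ⟨c, hc⟩ := IsAlgClosed.exists_pow_nat_eq P.leadingCoeff (n := 2) (by norm_num)
  refine ⟨C c * ∏ q ∈ P.roots.toFinset, (X - C q) ^ (P.rootMultiplicity q / 2), ?_⟩
  conv_lhs => rw [(IsAlgClosed.splits P).eq_prod_roots, Finset.prod_multiset_map_count]
  rw [mul_pow, ← C_pow, hc, ← Finset.prod_pow]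
  congr 1
  refine Finset.prod_congr rfl fun q _ => ?_
  rw [← pow_mul, Nat.div_mul_cancel (h q).two_dvd, count_roots]

theorem isSpecialPolyAux_of_fib_eq_singleton {f : F[X]} (hf : 2 ≤ f.natDegree) {y : F}
    (h : fib f y = {y}) : IsSpecialPolyAux f := by
  have hf0 : 0 < f.natDegree := by omega
  have hroots : (f - C y).roots = Multiset.replicate f.natDegree y := by
    rw [Multiset.eq_replicate]
    constructor
    · rw [← (IsAlgClosed.splits (f - C y)).natDegree_eq_card_roots, natDegree_sub_C]
    · intro b hb
      have : b ∈ fib f y := by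
        rw [mem_fib hf0]
        simpa [sub_eq_zero] using (mem_roots'.1 hb).2
      simpa [h] using this
  have hfac := (IsAlgClosed.splits (f - C y)).eq_prod_roots
  rw [hroots] at hfac
  set c := (f - C y).leadingCoeff with hc
  have hc0 : c ≠ 0 := leadingCoeff_ne_zero.2 (sub_C_ne_zero hf0 y)
  simp only [Multiset.map_replicate, Multiset.prod_replicate] at hfac
  obtain ⟨a, ha⟩ := IsAlgClosed.exists_pow_nat_eq c⁻¹ (n := f.natDegree - 1) (by omega)
  have ha0 : a ≠ 0 := by
    rintro rfl
    rw [zero_pow (by omega)] at ha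
    exact hc0 (inv_eq_zero.1 ha.symm)
  refine ⟨a, y, ha0, X ^ f.natDegree, Or.inl rfl, Polynomial.funext fun x => ?_⟩
  have h1 := congrArg (eval (a * x + y)) hfac
  simp only [eval_sub, eval_mul, eval_pow, eval_C, eval_X, add_sub_cancel_right] at h1
  simp only [eval_comp, eval_add, eval_mul, eval_C, eval_X, eval_pow]
  obtain ⟨k, hk⟩ : ∃ k, f.natDegree = k + 1 := ⟨f.natDegree - 1, by omega⟩
  rw [hk, Nat.add_sub_cancel] at ha
  have h2 : c * a ^ k = 1 := by rw [ha]; exact mul_inv_cancel₀ hc0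
  rw [sub_eq_iff_eq_add.1 h1, hk]
  linear_combination -(a * x ^ (k + 1)) * h2

variable [CharZero F]

theorem isSpecialPolyAux_of_oddFib_eq {f : F[X]} (hf : 0 < f.natDegree) {T : Finset F}
    (hT : T.card = 2) (h : oddFib f T = T) : IsSpecialPolyAux f := by
  classical
  obtain ⟨y₁, y₂, hne, rfl⟩ := Finset.card_eq_two.1 hT
  have hodd : ∀ q, (f.eval q = y₁ ∨ f.eval q = y₂) ∧ Odd (mu f q) ↔ q = y₁ ∨ q = y₂ := by
    intro q
    have h1 := mem_oddFib hf (T := {y₁, y₂}) (q := q)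
    rw [h] at h1
    simpa using h1.symm
  set Q := (f - C y₁) * (f - C y₂) with hQ
  have hQ0 : Q ≠ 0 := mul_ne_zero (sub_C_ne_zero hf _) (sub_C_ne_zero hf _)
  have hmult : ∀ q, Q.rootMultiplicity q =
      if f.eval q = y₁ ∨ f.eval q = y₂ then mu f q else 0 := by
    have haux : ∀ y q, f.eval q ≠ y → (f - C y).rootMultiplicity q = 0 := by
      intro y q hy
      rw [rootMultiplicity_eq_zero_iff]
      intro hr
      exact absurd (by simpa [sub_eq_zero] using hr) hy
    intro q
    rw [hQ, rootMultiplicity_mul hQ0]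
    split_ifs with h1
    · rcases h1 with h1 | h1
      · rw [← mu_eq h1, haux y₂ q (h1 ▸ hne), add_zero]
      · rw [← mu_eq h1, haux y₁ q (h1 ▸ hne.symm), zero_add]
    · push Not at h1
      rw [haux _ _ h1.1, haux _ _ h1.2]
  have hQodd : ∀ q, Odd (Q.rootMultiplicity q) ↔ q = y₁ ∨ q = y₂ := by
    intro q
    rw [hmult]
    refine Iff.trans ?_ (hodd q)
    split_ifs with h1 <;> simp [h1]
  have hd1 : X - C y₁ ∣ Q :=
    dvd_iff_isRoot.2 ((rootMultiplicity_pos hQ0).1 ((hQodd y₁).2 (Or.inl rfl)).pos)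
  have hd2 : X - C y₂ ∣ Q :=
    dvd_iff_isRoot.2 ((rootMultiplicity_pos hQ0).1 ((hQodd y₂).2 (Or.inr rfl)).pos)
  have hcop : IsCoprime (X - C y₁) (X - C y₂) :=
    isCoprime_X_sub_C_of_isUnit_sub (sub_ne_zero.2 hne).isUnit
  obtain ⟨R, hR⟩ := hcop.mul_dvd hd1 hd2
  have hR0 : R ≠ 0 := by
    rintro rfl
    exact hQ0 (by simpa using hR)
  obtain ⟨w, hw⟩ := exists_sq_of_even_rootMultiplicity (P := R) (by
    intro q
    have h1 := hQodd q
    rw [hR, rootMultiplicity_mul (hR ▸ hQ0), rootMultiplicity_mul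
      (left_ne_zero_of_mul (hR ▸ hQ0)), rootMultiplicity_X_sub_C, rootMultiplicity_X_sub_C] at h1
    by_contra hev
    rw [Nat.not_even_iff_odd] at hev
    by_cases h2 : q = y₁
    · subst h2
      simp [hne, Nat.odd_add] at h1
      exact absurd h1 (by rwa [Nat.not_even_iff_odd])
    · by_cases h3 : q = y₂
      · subst h3
        simp [h2, Nat.odd_add] at h1
        exact absurd h1 (by rwa [Nat.not_even_iff_odd])
      · simp [h2, h3, hev] at h1)
  set a := (y₁ - y₂) / 4 with ha
  set b := (y₁ + y₂) / 2 with hb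
  have ha0 : a ≠ 0 := div_ne_zero (sub_ne_zero.2 hne) (by norm_num)
  have hy₁ : y₁ = 2 * a + b := by rw [ha, hb]; ring
  have hy₂ : y₂ = -2 * a + b := by rw [ha, hb]; ring
  set L : F[X] := C a * X + C b with hL
  have hLdeg : L.natDegree = 1 := natDegree_linear ha0
  set G := C a⁻¹ * (f.comp L - C b) with hG
  have hGdeg : G.natDegree = f.natDegree := by
    rw [hG, natDegree_C_mul (inv_ne_zero ha0), natDegree_sub_C, natDegree_comp, hLdeg, mul_one]
  have haG : f.comp L = C a * G + C b := by
    rw [hG, ← mul_assoc, ← C_mul, mul_inv_cancel₀ ha0]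
    simp
  have hpell : G ^ 2 - 4 = (X ^ 2 - 4) * (w.comp L) ^ 2 := by
    have h1 := congrArg (fun P => P.comp L) (hQ.symm.trans hR)
    simp only [hw, mul_comp, sub_comp, C_comp, X_comp, pow_comp, haG, hy₁, hy₂] at h1
    refine mul_left_cancel₀ (pow_ne_zero 2 (C_ne_zero.2 ha0)) ?_
    rw [hL] at h1 ⊢
    simp only [C_add, C_mul, C_neg, show (C 2 : F[X]) = 2 from map_ofNat C 2] at h1
    linear_combination h1
  have hspec := isChebyshevPoly_of_pell (hGdeg ▸ hf) hpell
  rw [hGdeg] at hspec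
  refine ⟨a, b, ha0, G, Or.inr hspec, ?_⟩
  rw [haG]
  simp

theorem SpecialType.isSpecialPolyAux {f : F[X]} (hf : 2 ≤ f.natDegree) (h : SpecialType f) :
    IsSpecialPolyAux f := by
  rcases h with ⟨y, hy⟩ | ⟨T, hT, h⟩
  · exact isSpecialPolyAux_of_fib_eq_singleton hf hy
  · exact isSpecialPolyAux_of_oddFib_eq (by omega) hT h

end Special

section Degrees

theorem exists_prime_pow_eq_mul {D n : ℕ} (hD : 2 ≤ D) (hn : 2 ≤ n) :
    ∃ p a b M : ℕ, p.Prime ∧ p ∣ D ∧ 1 ≤ b ∧ n ^ b = D ^ a * M ∧ ¬ p ∣ M := by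
  have hne : D.primeFactors.Nonempty := Nat.nonempty_primeFactors.2 hD
  obtain ⟨p, hp, hmin⟩ := Finset.exists_min_image D.primeFactors
    (fun q => (n.factorization q : ℚ) / D.factorization q) hne
  have hD0 : D ≠ 0 := by omega
  have hn0 : n ≠ 0 := by omega
  have hpp := Nat.prime_of_mem_primeFactors hp
  have hpD := Nat.dvd_of_mem_primeFactors hp
  have hpos : ∀ q ∈ D.primeFactors, 0 < D.factorization q := fun q hq =>
    (Nat.prime_of_mem_primeFactors hq).factorization_pos_of_dvd hD0 (Nat.dvd_of_mem_primeFactors hq)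
  have hle : ∀ q, n.factorization p * D.factorization q ≤
      D.factorization p * n.factorization q := by
    intro q
    by_cases hq : q ∈ D.primeFactors
    · have h1 := hmin q hq
      rw [div_le_div_iff₀ (by exact_mod_cast hpos p hp) (by exact_mod_cast hpos q hq)] at h1
      rw [mul_comm (D.factorization p)]
      exact_mod_cast h1
    · rw [← Nat.support_factorization, Finsupp.notMem_support_iff] at hq
      simp [hq]
  have hdvd : D ^ n.factorization p ∣ n ^ D.factorization p := by
    rw [← Nat.factorization_le_iff_dvd (pow_ne_zero _ hD0) (pow_ne_zero _ hn0),
      Nat.factorization_pow, Nat.factorization_pow]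
    intro q
    simpa using hle q
  obtain ⟨M, hM⟩ := hdvd
  refine ⟨p, _, _, M, hpp, hpD, hpos p hp, hM, fun hpM => ?_⟩
  have hM0 : M ≠ 0 := by
    rintro rfl
    exact pow_ne_zero _ hn0 (by simpa using hM)
  have h1 := congrArg (fun N => N.factorization p) hM
  simp only [Nat.factorization_mul (pow_ne_zero _ hD0) hM0, Nat.factorization_pow,
    Finsupp.add_apply, Finsupp.smul_apply, smul_eq_mul] at h1
  have h2 := hpp.factorization_pos_of_dvd hM0 hpM
  rw [mul_comm] at h1
  omega

variable {F : Type} [Field F] [IsAlgClosed F] [CharZero F]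

theorem exists_comp_of_commute_of_dvd {f g h : F[X]} (hf : 2 ≤ f.natDegree)
    (hg : PolyCommute f g) (hh : PolyCommute f h) (hg0 : 0 < g.natDegree) (hh0 : 0 < h.natDegree)
    (hdvd : g.natDegree ∣ h.natDegree) : ∃ u, h = u.comp g ∧ PolyCommute f u := by
  obtain ⟨a, b, ha, hb, hab⟩ := exists_ore_relation hf hg hh hg0 hh0
  obtain ⟨u, hu⟩ := exists_comp_of_dvd hb ha hg0 hh0 hab.symm hdvd
  refine ⟨u, hu, comp_right_cancel hg0 ?_⟩
  rw [comp_assoc, ← hu, show f.comp h = h.comp f from hh, hu, comp_assoc, comp_assoc,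
    show g.comp f = f.comp g from hg.symm]

theorem specialType_or_pow_natDegree_eq {f h : F[X]} (hf : 2 ≤ f.natDegree)
    (hh : 2 ≤ h.natDegree) (hfh : PolyCommute f h) :
    SpecialType f ∨ ∃ a b, 1 ≤ a ∧ 1 ≤ b ∧ h.natDegree ^ a = f.natDegree ^ b := by
  obtain ⟨p, a, b, M, hp, hpD, hb, hM, hpM⟩ := exists_prime_pow_eq_mul hf hh
  have hfa := natDegree_polIter_pos (f := f) (by omega) a
  have hhb := natDegree_polIter_pos (f := h) (by omega) b
  obtain ⟨u, hu, hfu⟩ := exists_comp_of_commute_of_dvd hf ((PolyCommute.refl f).iter_right a)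
    (hfh.iter_right b) hfa hhb (by rw [natDegree_polIter, natDegree_polIter, hM]; simp)
  have hudeg : u.natDegree = M := by
    have h1 := congrArg natDegree hu
    rw [natDegree_comp, natDegree_polIter, natDegree_polIter, hM, mul_comm] at h1
    exact (Nat.eq_of_mul_eq_mul_right (pow_pos (by omega) a) h1).symm
  have hM0 : M ≠ 0 := by
    rintro rfl
    exact hpM (dvd_zero p)
  by_cases hM1 : M = 1
  · right
    refine ⟨b, a, hb, ?_, by rw [hM, hM1, mul_one]⟩
    by_contra ha
    have ha0 : a = 0 := by omega
    rw [ha0, hM1] at hM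
    have := Nat.one_lt_pow (n := b) (by omega) (show 1 < h.natDegree by omega)
    simp at hM
    omega
  · left
    have hu2 : 2 ≤ u.natDegree := by omega
    exact SpecialType.of_commute (by omega) hu2 hfu
      (specialType_of_prime hfu hu2 (by omega) hp hpD (by rwa [hudeg]))

/-- The degree of a polynomial commuting with a disintegrated `f` is multiplicatively dependent
on the degree of `f`. -/
theorem exists_pow_natDegree_eq {f h : F[X]} {m : ℕ} (hdis : IsDisintegratedAux f) (hm : 1 ≤ m)
    (hfh : PolyCommute (polIter f m) h) (hh : 0 < h.natDegree) :
    ∃ a b, 1 ≤ a ∧ h.natDegree ^ a = f.natDegree ^ b := by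
  obtain ⟨hf, hdis⟩ := hdis
  by_cases h1 : h.natDegree = 1
  · exact ⟨1, 0, le_rfl, by simp [h1]⟩
  have hfm : 2 ≤ (polIter f m).natDegree := by
    rw [natDegree_polIter]
    exact hf.trans (Nat.le_self_pow (by omega) _)
  rcases specialType_or_pow_natDegree_eq hfm (by omega) hfh with hs | ⟨a, b, ha, -, hab⟩
  · exact absurd ((hs.of_commute (by omega) hfm
      ((PolyCommute.refl f).iter_right m)).isSpecialPolyAux hf) hdis
  · refine ⟨a, m * b, ha, ?_⟩
    rw [hab, natDegree_polIter, pow_mul]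

theorem natDegree_dvd_of_le {f g h : F[X]} {m₁ m₂ : ℕ} (hdis : IsDisintegratedAux f)
    (hm₁ : 1 ≤ m₁) (hm₂ : 1 ≤ m₂) (hg : PolyCommute (polIter f m₁) g)
    (hh : PolyCommute (polIter f m₂) h) (hg0 : 0 < g.natDegree) (hh0 : 0 < h.natDegree)
    (hle : g.natDegree ≤ h.natDegree) : g.natDegree ∣ h.natDegree := by
  obtain ⟨a, b, ha, hab⟩ := exists_pow_natDegree_eq hdis hm₁ hg hg0
  obtain ⟨c, d, hc, hcd⟩ := exists_pow_natDegree_eq hdis hm₂ hh hh0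
  have hf := hdis.1
  rw [← Nat.pow_dvd_pow_iff (n := a * c) (by positivity)]
  have h1 : g.natDegree ^ (a * c) = f.natDegree ^ (b * c) := by rw [pow_mul, hab, pow_mul]
  have h2 : h.natDegree ^ (a * c) = f.natDegree ^ (d * a) := by
    rw [mul_comm, pow_mul, hcd, pow_mul]
  rw [h1, h2]
  refine pow_dvd_pow _ ((Nat.pow_le_pow_iff_right (show 1 < f.natDegree by omega)).1 ?_)
  rw [← h1, ← h2]
  exact Nat.pow_le_pow_left hle _

/-- Polynomials commuting with a common iterate of a disintegrated `f` are totally ordered by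
right divisibility. -/
theorem exists_comp_of_natDegree_le {f g h : F[X]} {m : ℕ} (hdis : IsDisintegratedAux f)
    (hm : 1 ≤ m) (hg : PolyCommute (polIter f m) g) (hh : PolyCommute (polIter f m) h)
    (hg0 : 0 < g.natDegree) (hle : g.natDegree ≤ h.natDegree) :
    ∃ u, h = u.comp g ∧ PolyCommute (polIter f m) u := by
  have hfm : 2 ≤ (polIter f m).natDegree := by
    rw [natDegree_polIter]
    exact hdis.1.trans (Nat.le_self_pow (by omega) _)
  exact exists_comp_of_commute_of_dvd hfm hg hh hg0 (hg0.trans_le hle)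
    (natDegree_dvd_of_le hdis hm hm hg hh hg0 (hg0.trans_le hle) hle)

end Degrees

section Variety

section Action

variable {F : Type} [Field F]

theorem polyEvalP1_comp (p q : F[X]) (x : OnePoint F) :
    polyEvalP1 (p.comp q) x = polyEvalP1 p (polyEvalP1 q x) := by
  cases x <;> simp [polyEvalP1]

theorem iterate_polyEvalP1 (f : F[X]) (k : ℕ) (x : OnePoint F) :
    (polyEvalP1 f)^[k] x = polyEvalP1 (polIter f k) x := by
  induction k generalizing x with
  | zero => cases x <;> simp [polIter, polyEvalP1]
  | succ k ih => rw [Function.iterate_succ_apply', ih, polIter, polyEvalP1_comp]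

theorem iterate_splitMap {ι : Type} (f : F[X]) (k : ℕ) (x : ι → OnePoint F) (i : ι) :
    (splitMap f)^[k] x i = polyEvalP1 (polIter f k) (x i) := by
  rw [← iterate_polyEvalP1]
  induction k with
  | zero => rfl
  | succ k ih => rw [Function.iterate_succ_apply', Function.iterate_succ_apply', splitMap, ih]

theorem image_iterate_mul {α : Type*} {φ : α → α} {S : Set α} {m : ℕ} (h : φ^[m] '' S = S)
    (t : ℕ) : φ^[m * t] '' S = S := by
  induction t with
  | zero => simp
  | succ t ih => rw [Nat.mul_succ, Function.iterate_add, Set.image_comp, h, ih]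

theorem isZarClosed_coord_eq {ι : Type} [DecidableEq ι] (j : ι) (ζ : OnePoint F) :
    IsZarClosed {x : ι → OnePoint F | x j = ζ} := by
  refine ⟨⟨{MvPolynomial.C (homCoords ζ 1) * MvPolynomial.X (j, 0) -
    MvPolynomial.C (homCoords ζ 0) * MvPolynomial.X (j, 1)}, ?_⟩, ?_⟩
  · rintro p rfl i
    refine ⟨if j = i then 1 else 0, ?_⟩
    have h : ∀ (c : F) (e : Fin 2), (MvPolynomial.C c * MvPolynomial.X (j, e) :
        MvPolynomial (ι × Fin 2) F).IsWeightedHomogeneous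
        (fun jk => if jk.1 = i then (1 : ℕ) else 0) (if j = i then 1 else 0) := by
      intro c e
      have := (MvPolynomial.isWeightedHomogeneous_C
        (fun jk : ι × Fin 2 => if jk.1 = i then (1 : ℕ) else 0) c).mul
        (MvPolynomial.isWeightedHomogeneous_X F
          (fun jk : ι × Fin 2 => if jk.1 = i then (1 : ℕ) else 0) (j, e))
      simpa using this
    exact (MvPolynomial.weightedHomogeneousSubmodule F _ _).sub_mem (h _ 0) (h _ 1)
  · ext x
    simp only [Set.mem_ofPred_eq, ClosedSubvar.pts, Set.mem_singleton_iff, forall_eq, vanishesAt,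
      MvPolynomial.map_id, map_sub, map_mul, MvPolynomial.eval_C,
      MvPolynomial.eval_X]
    generalize x j = z
    have h0 : ∀ a : F, homCoords (a : OnePoint F) = ![a, 1] := fun _ => rfl
    have h1 : homCoords (∞ : OnePoint F) = ![1, 0] := rfl
    cases z <;> cases ζ <;> simp [h0, h1, sub_eq_zero]

variable {n : ℕ} {f g : F[X]} {V : Set (Fin n → OnePoint F)}

theorem p1Periodic_of_eval_polIter {m : ℕ} {c : F} (hm : 1 ≤ m)
    (h : (polIter f m).eval c = c) : P1Periodic f (c : OnePoint F) := by
  refine ⟨m, hm, ?_⟩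
  have := iterate_polyEvalP1 f m (c : OnePoint F)
  simpa [polyEvalP1, h] using this

theorem natDegree_pos_of_not_memIV (hV : IrrSubvar V) {i j : Fin n}
    (hg : CommutesWithIterate f g) (hj : ¬ memIV f V j)
    (h : ∀ x ∈ V, x j = polyEvalP1 g (x i)) : 0 < g.natDegree := by
  by_contra h0
  obtain ⟨c, rfl⟩ := natDegree_eq_zero.1 (Nat.eq_zero_of_not_pos h0)
  obtain ⟨m, hm, hg⟩ := hg
  have hc : (polIter f m).eval c = c := by
    have := congrArg (eval 0) (show _ = _ from hg)
    simpa using this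
  rcases hV.2.2 _ _ (isZarClosed_coord_eq j (c : OnePoint F)) (isZarClosed_coord_eq j ∞) (by
    intro x hx
    have h1 := h x hx
    generalize x i = z at h1
    cases z
    · exact Or.inr (by simpa [polyEvalP1] using h1)
    · exact Or.inl (by simpa [polyEvalP1] using h1)) with h1 | h1
  · exact hj ⟨c, p1Periodic_of_eval_polIter hm hc, fun x hx => h1 hx⟩
  · exact hj ⟨∞, ⟨1, le_rfl, rfl⟩, fun x hx => h1 hx⟩

theorem exists_of_precRel (hV : IrrSubvar V) {i j : Fin n} (h : precRel f V i j) :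
    ∃ m g, 1 ≤ m ∧ PolyCommute (polIter f m) g ∧ 0 < g.natDegree ∧
      ∀ x ∈ V, x j = polyEvalP1 g (x i) := by
  obtain ⟨-, hj, rfl | ⟨g, ⟨m, hm, hg⟩, hx⟩⟩ := h
  · refine ⟨1, X, le_rfl, by simp [PolyCommute], by simp, fun x _ => ?_⟩
    generalize x i = z
    cases z <;> simp [polyEvalP1]
  · exact ⟨m, g, hm, hg, natDegree_pos_of_not_memIV hV ⟨m, hm, hg⟩ hj hx, hx⟩

theorem _root_.PolyCommute.polIter_mul_left {m : ℕ} (h : PolyCommute (polIter f m) g) (t : ℕ) :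
    PolyCommute (polIter f (m * t)) g := by
  rw [polIter_mul]
  exact h.iter_left t

theorem _root_.PolyCommute.polIter_mul_right {m : ℕ} (h : PolyCommute (polIter f m) g) (t : ℕ) :
    PolyCommute (polIter f (t * m)) g := by
  rw [mul_comm]
  exact h.polIter_mul_left t

theorem precRel_trans (hV : IrrSubvar V) {i j k : Fin n} (hij : precRel f V i j)
    (hjk : precRel f V j k) : precRel f V i k := by
  obtain ⟨m₁, g, hm₁, hg, -, hx⟩ := exists_of_precRel hV hij
  obtain ⟨m₂, h, hm₂, hh, -, hx'⟩ := exists_of_precRel hV hjk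
  refine ⟨hij.1, hjk.2.1, Or.inr ⟨h.comp g, ⟨m₁ * m₂, Nat.mul_pos hm₁ hm₂, ?_⟩, fun x hxV => ?_⟩⟩
  · exact (hh.polIter_mul_right m₁).comp_right (hg.polIter_mul_left m₂)
  · rw [polyEvalP1_comp, ← hx x hxV, hx' x hxV]

end Action

variable {F : Type} [Field F] [IsAlgClosed F] [CharZero F] {n : ℕ} {f : F[X]}
  {V : Set (Fin n → OnePoint F)}

theorem precRel_or_of_common_left (hdis : IsDisintegratedAux f) (hV : IrrSubvar V) {i j k : Fin n}
    (hij : precRel f V i j) (hik : precRel f V i k) : precRel f V j k ∨ precRel f V k j := by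
  have key : ∀ {j k : Fin n} {m : ℕ} {g h : F[X]}, 1 ≤ m → PolyCommute (polIter f m) g →
      PolyCommute (polIter f m) h → 0 < g.natDegree → g.natDegree ≤ h.natDegree →
      (∀ x ∈ V, x j = polyEvalP1 g (x i)) → (∀ x ∈ V, x k = polyEvalP1 h (x i)) →
      ¬ memIV f V j → ¬ memIV f V k → precRel f V j k := by
    intro j k m g h hm hg hh hg0 hle hx hx' hj hk
    obtain ⟨u, rfl, hu⟩ := exists_comp_of_natDegree_le hdis hm hg hh hg0 hle
    exact ⟨hj, hk, Or.inr ⟨u, ⟨m, hm, hu⟩, fun x hxV => by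
      rw [hx' x hxV, polyEvalP1_comp, ← hx x hxV]⟩⟩
  obtain ⟨m₁, g, hm₁, hg, hg0, hx⟩ := exists_of_precRel hV hij
  obtain ⟨m₂, h, hm₂, hh, hh0, hx'⟩ := exists_of_precRel hV hik
  have hm : 1 ≤ m₁ * m₂ := Nat.mul_pos hm₁ hm₂
  replace hg := hg.polIter_mul_left m₂
  replace hh := hh.polIter_mul_right m₁
  rcases le_total g.natDegree h.natDegree with hle | hle
  · exact Or.inl (key hm hg hh hg0 hle hx hx' hij.2.1 hik.2.1)
  · exact Or.inr (key hm hh hg hh0 hle hx' hx hik.2.1 hij.2.1)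

theorem precRel_or_of_common_right (hdis : IsDisintegratedAux f) (hV : IrrSubvar V)
    (hper : SubvarPeriodic f V) {i j k : Fin n} (hik : precRel f V i k) (hjk : precRel f V j k) :
    precRel f V i j ∨ precRel f V j i := by
  have key : ∀ {i j : Fin n} {m : ℕ} {g h : F[X]}, 1 ≤ m → (splitMap f)^[m] '' V = V →
      PolyCommute (polIter f m) g → PolyCommute (polIter f m) h → 0 < h.natDegree →
      h.natDegree ≤ g.natDegree → (∀ x ∈ V, x k = polyEvalP1 g (x i)) →
      (∀ x ∈ V, x k = polyEvalP1 h (x j)) →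
      ¬ memIV f V i → ¬ memIV f V j → precRel f V i j := by
    intro i j m g h hm hVm hg hh hh0 hle hx hx' hi hj
    have hdeg : ∀ K, (polIter f (m * K)).natDegree = (f.natDegree ^ m) ^ K := fun K => by
      rw [natDegree_polIter, pow_mul]
    have hfm : 1 < f.natDegree ^ m := Nat.one_lt_pow (by omega) hdis.1
    set P := polIter f (m * h.natDegree) with hP
    have hPc : PolyCommute (polIter f m) P := by
      rw [hP, polIter_mul]
      exact (PolyCommute.refl _).iter_right _
    have hPle : h.natDegree ≤ P.natDegree := by
      rw [hP, hdeg]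
      exact (Nat.lt_pow_self hfm).le
    obtain ⟨v, hv, hvc⟩ := exists_comp_of_natDegree_le hdis hm hh hPc hh0 hPle
    obtain ⟨u, hu, huc⟩ := exists_comp_of_natDegree_le hdis hm hPc (hvc.comp_right hg)
      (hh0.trans_le hPle) (by
        rw [hv, natDegree_comp, natDegree_comp]
        exact Nat.mul_le_mul_left _ hle)
    refine ⟨hi, hj, Or.inr ⟨u, ⟨m, hm, huc⟩, fun x hxV => ?_⟩⟩
    rw [← image_iterate_mul hVm h.natDegree] at hxV
    obtain ⟨y, hy, rfl⟩ := hxV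
    rw [iterate_splitMap, iterate_splitMap, ← hP, ← polyEvalP1_comp, ← hu, hv, polyEvalP1_comp,
      polyEvalP1_comp, ← hx y hy, ← hx' y hy]
  obtain ⟨m₁, g, hm₁, hg, hg0, hx⟩ := exists_of_precRel hV hik
  obtain ⟨m₂, h, hm₂, hh, hh0, hx'⟩ := exists_of_precRel hV hjk
  obtain ⟨m₃, hm₃, hVm⟩ := hper
  have hm : 1 ≤ m₃ * (m₁ * m₂) := Nat.mul_pos hm₃ (Nat.mul_pos hm₁ hm₂)
  replace hg := (hg.polIter_mul_left m₂).polIter_mul_right m₃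
  replace hh := (hh.polIter_mul_right m₁).polIter_mul_right m₃
  replace hVm := image_iterate_mul hVm (m₁ * m₂)
  rcases le_total h.natDegree g.natDegree with hle | hle
  · exact Or.inl (key hm hVm hg hh hh0 hle hx hx' hik.1 hjk.1)
  · exact Or.inr (key hm hVm hh hg hg0 hle hx' hx hjk.1 hik.1)

end Variety

end PolyDyn

/-- **Chain properties of the relation `≺`** (Lemma 2.5).

Let `F` be an algebraically closed field of characteristic 0, `n ≥ 2`, `f ∈ F[X]` a
disintegrated polynomial of degree at least 2, `φ = (f,…,f)`, and `V` an irreducible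
`φ`-periodic subvariety of `(P^1_F)^n`. Then the relation `≺` satisfies:
(a) transitivity; (b) upper chain extension; (c) lower chain extension. -/
theorem prec_relation_chain_properties
    (F : Type) [Field F] [IsAlgClosed F] [CharZero F]
    (n : ℕ) (hn : 2 ≤ n)
    (f : Polynomial F) (hf : 2 ≤ f.natDegree) (hdis : IsDisintegratedAux f)
    (V : Set (Fin n → OnePoint F)) (hVirr : IrrSubvar V) (hVper : SubvarPeriodic f V) :
    (∀ i j k : Fin n, precRel f V i j → precRel f V j k → precRel f V i k) ∧
    (∀ i j k : Fin n, precRel f V i j → precRel f V i k →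
      precRel f V j k ∨ precRel f V k j) ∧
    (∀ i j k : Fin n, precRel f V i k → precRel f V j k →
      precRel f V i j ∨ precRel f V j i) := by
  exact ⟨fun _ _ _ => PolyDyn.precRel_trans hVirr,
    fun _ _ _ => PolyDyn.precRel_or_of_common_left hdis hVirr,
    fun _ _ _ => PolyDyn.precRel_or_of_common_right hdis hVirr hVper⟩
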